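/- Let K be a field of characteristic zero and let n ≥ 1 and r ≥ 1 be integers. Then there exists a nonzero polynomial G in 4n variables over K such that for every tuple (v_1,…,v_n) of nonzero vectors in K^4 with G(v_1,…,v_n) ≠ 0, the ideal I = ⋂_{j=1}^n m_{v_j} of the corresponding simple points in P^3 satisfies I^{(3r-1)} ⊆ M^{2r-1} · I^r. -/

import Mathlib

open MvPolynomial Filter

noncomputable section

/-- The ideal of a point of `ℙ³` represented by a nonzero vector `v ∈ K⁴`:
the ideal generated by all linear forms vanishing at `v`. -/
def pointIdeal (K : Type) [Field K] (v : Fin 4 → K) : Ideal (MvPolynomial (Fin 4) K) :=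
  Ideal.span {f | f.IsHomogeneous 1 ∧ eval v f = 0}

/-- The irrelevant maximal ideal `M = (x₀, x₁, x₂, x₃)`. -/
def irrIdeal (K : Type) [Field K] : Ideal (MvPolynomial (Fin 4) K) :=
  Ideal.span (Set.range X)

section Graded

variable {σ K : Type*} [Field K]

/-- The degree `t` part of an ideal of a polynomial ring. -/
def gradedPart (I : Ideal (MvPolynomial σ K)) (t : ℕ) : Submodule K (MvPolynomial σ K) :=
  I.restrictScalars K ⊓ homogeneousSubmodule σ K t

lemma mem_gradedPart {I : Ideal (MvPolynomial σ K)} {t : ℕ} {f : MvPolynomial σ K} :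
    f ∈ gradedPart I t ↔ f ∈ I ∧ f.IsHomogeneous t := by
  simp [gradedPart]

lemma mul_mem_gradedPart {I : Ideal (MvPolynomial σ K)} {t k : ℕ} {f g : MvPolynomial σ K}
    (hg : g.IsHomogeneous k) (hf : f ∈ gradedPart I t) : g * f ∈ gradedPart I (k + t) := by
  rw [mem_gradedPart] at *
  exact ⟨I.mul_mem_left _ hf.1, hg.mul hf.2⟩

lemma isHomogeneous_of_X_mul {z : σ} {h : MvPolynomial σ K} {k : ℕ}
    (H : (X z * h).IsHomogeneous (k + 1)) : h.IsHomogeneous k := by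
  intro e he
  have := @H (Finsupp.single z 1 + e) (by rwa [coeff_X_mul])
  rw [map_add] at this
  simp only [Finsupp.weight_single, Pi.one_apply, smul_eq_mul, mul_one] at this
  omega

lemma X_mul_mem_gradedPart {I : Ideal (MvPolynomial σ K)} {z : σ}
    (hI : ∀ f, X z * f ∈ I → f ∈ I) {t : ℕ} {f : MvPolynomial σ K}
    (hf : X z * f ∈ gradedPart I (t + 1)) : f ∈ gradedPart I t := by
  rw [mem_gradedPart] at *
  exact ⟨hI _ hf.1, isHomogeneous_of_X_mul hf.2⟩

/-- Modulo the variable `z`, every monomial of degree `t` lifts to an element of `I`. -/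
def LiftsMonomials (I : Ideal (MvPolynomial σ K)) (z : σ) (t : ℕ) : Prop :=
  ∀ a : σ →₀ ℕ, a.degree = t → ∃ p ∈ gradedPart I t, X z ∣ p - monomial a 1

lemma degree_of_mem_support {P : MvPolynomial σ K} {t : ℕ} (hP : P.IsHomogeneous t)
    {a : σ →₀ ℕ} (ha : a ∈ P.support) : a.degree = t := by
  by_contra h
  exact (mem_support_iff.1 ha) (hP.coeff_eq_zero h)

lemma X_dvd_sub_sum_smul {z : σ} {P : MvPolynomial σ K} {y : (σ →₀ ℕ) → MvPolynomial σ K}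
    (hy : ∀ c ∈ P.support, X z ∣ y c - monomial c 1) :
    X z ∣ P - ∑ c ∈ P.support, coeff c P • y c := by
  have h : P = ∑ c ∈ P.support, coeff c P • monomial c 1 := by
    conv_lhs => rw [P.as_sum]
    refine Finset.sum_congr rfl fun c _ => ?_
    rw [smul_monomial, smul_eq_mul, mul_one]
  have : P - ∑ c ∈ P.support, coeff c P • y c
      = ∑ c ∈ P.support, coeff c P • (monomial c 1 - y c) := by
    simp only [smul_sub, Finset.sum_sub_distrib, ← h]
  rw [this]
  refine Finset.dvd_sum fun c hc => ?_
  rw [smul_eq_C_mul]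
  exact dvd_mul_of_dvd_right ((dvd_sub_comm).1 (hy c hc)) _

lemma gradedPart_succ_le {J : Ideal (MvPolynomial σ K)} {z : σ}
    (hJz : ∀ f, X z * f ∈ J → f ∈ J) {w : ℕ} (hJ : LiftsMonomials J z w) :
    gradedPart J (w + 1) ≤ homogeneousSubmodule σ K 1 * gradedPart J w := by
  classical
  intro q hq
  have key : ∀ c ∈ q.support, ∃ y ∈ homogeneousSubmodule σ K 1 * gradedPart J w,
      X z ∣ y - monomial c (1 : K) := by
    intro c hc
    have hdeg : c.degree = w + 1 := degree_of_mem_support (mem_gradedPart.1 hq).2 hc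
    have hne : c ≠ 0 := by rintro rfl; simp at hdeg
    obtain ⟨i, hi⟩ := Finsupp.ne_iff.1 hne
    have hle : Finsupp.single i 1 ≤ c := by
      simp only [Finsupp.single_le_iff]; simp at hi; omega
    obtain ⟨c', rfl⟩ := le_iff_exists_add.1 hle
    obtain ⟨p, hp, hd⟩ := hJ c' (by simp at hdeg; omega)
    refine ⟨X i * p, Submodule.mul_mem_mul (by simpa using isHomogeneous_X K i) hp, ?_⟩
    have : X i * p - monomial (Finsupp.single i 1 + c') (1 : K)
        = X i * (p - monomial c' 1) := by
      rw [mul_sub, X, monomial_mul, one_mul]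
    rw [this]
    exact dvd_mul_of_dvd_right hd _
  choose! y hy hyd using key
  set S := ∑ c ∈ q.support, coeff c q • y c with hS
  have hSm : S ∈ homogeneousSubmodule σ K 1 * gradedPart J w :=
    Submodule.sum_mem _ fun c hc => Submodule.smul_mem _ _ (hy c hc)
  have hle : homogeneousSubmodule σ K 1 * gradedPart J w ≤ gradedPart J (w + 1) := by
    rw [Submodule.mul_le]
    intro m hm n hn
    rw [add_comm]
    exact mul_mem_gradedPart hm hn
  have hdvd : X z ∣ q - S := X_dvd_sub_sum_smul hyd
  obtain ⟨h, hh⟩ := hdvd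
  have hh' : X z * h ∈ gradedPart J (w + 1) := hh ▸ Submodule.sub_mem _ hq (hle hSm)
  have : q = S + X z * h := by rw [← hh]; ring
  rw [this]
  exact Submodule.add_mem _ hSm (Submodule.mul_mem_mul (by simpa using isHomogeneous_X K z)
    (X_mul_mem_gradedPart hJz hh'))

/-- `z` times the product of the graded parts. -/
def shifted (I J : Ideal (MvPolynomial σ K)) (z : σ) (d w : ℕ) :
    Submodule K (MvPolynomial σ K) :=
  (gradedPart I d * gradedPart J w).map (LinearMap.mulLeft K (X z))

lemma mul_mem_shifted_left {I J : Ideal (MvPolynomial σ K)} {z : σ} {d w : ℕ}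
    (hIz : ∀ f, X z * f ∈ I → f ∈ I) (hJz : ∀ f, X z * f ∈ J → f ∈ J)
    (hJ : LiftsMonomials J z w) {p q : MvPolynomial σ K}
    (hp : p ∈ gradedPart I d) (hpz : X z ∣ p) (hq : q ∈ gradedPart J (w + 1)) :
    p * q ∈ shifted I J z d w := by
  obtain ⟨g, rfl⟩ := hpz
  have hq' := gradedPart_succ_le hJz hJ hq
  induction hq' using Submodule.mul_induction_on' with
  | mem_mul_mem m hm n hn =>
    refine ⟨(g * m) * n, Submodule.mul_mem_mul ?_ hn, ?_⟩
    · apply X_mul_mem_gradedPart hIz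
      have := mul_mem_gradedPart (k := 1) hm hp
      rw [add_comm] at this
      convert this using 1; ring
    · simp only [LinearMap.mulLeft_apply]; ring
  | add x _ y _ hx hy =>
    have hle : homogeneousSubmodule σ K 1 * gradedPart J w ≤ gradedPart J (w + 1) := by
      rw [Submodule.mul_le]
      intro m hm n hn
      rw [add_comm]
      exact mul_mem_gradedPart hm hn
    rw [mul_add]
    exact Submodule.add_mem _ (hx (hle ‹_›)) (hy (hle ‹_›))

lemma mul_mem_shifted_right {I J : Ideal (MvPolynomial σ K)} {z : σ} {d w : ℕ}
    (hJz : ∀ f, X z * f ∈ J → f ∈ J) {p q : MvPolynomial σ K}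
    (hp : p ∈ gradedPart I d) (hq : q ∈ gradedPart J (w + 1)) (hqz : X z ∣ q) :
    p * q ∈ shifted I J z d w := by
  obtain ⟨g, rfl⟩ := hqz
  refine ⟨p * g, Submodule.mul_mem_mul hp (X_mul_mem_gradedPart hJz hq), ?_⟩
  simp only [LinearMap.mulLeft_apply]; ring

lemma balanced_mem_shifted {I J : Ideal (MvPolynomial σ K)} {z : σ} {d w : ℕ}
    (hIz : ∀ f, X z * f ∈ I → f ∈ I) (hJz : ∀ f, X z * f ∈ J → f ∈ J)
    (hI : LiftsMonomials I z d) (hJ : LiftsMonomials J z w) (n : ℕ) :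
    ∀ (a a' c c' : σ →₀ ℕ) (P P' Q Q' : MvPolynomial σ K), (a - a').degree = n →
      a.degree = d → a'.degree = d → c.degree = w + 1 → c'.degree = w + 1 → a + c = a' + c' →
      P ∈ gradedPart I d → X z ∣ P - monomial a 1 → P' ∈ gradedPart I d →
      X z ∣ P' - monomial a' 1 → Q ∈ gradedPart J (w + 1) → X z ∣ Q - monomial c 1 →
      Q' ∈ gradedPart J (w + 1) → X z ∣ Q' - monomial c' 1 →
      P * Q - P' * Q' ∈ shifted I J z d w := by
  induction n with
  | zero =>
    intro a a' c c' P P' Q Q' hn ha ha' hc hc' hac hP hPa hP' hPa' hQ hQc hQ' hQc'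
    have hle : a ≤ a' := by
      have : a - a' = 0 := (Finsupp.degree_eq_zero_iff _).1 hn
      exact tsub_eq_zero_iff_le.1 this
    obtain ⟨b, rfl⟩ := le_iff_exists_add.1 hle
    have hb : b = 0 := by
      refine (Finsupp.degree_eq_zero_iff _).1 ?_
      simp at ha'; omega
    subst hb
    have hcc : c = c' := by simpa using hac
    subst hcc
    have : P * Q - P' * Q' = (P - P') * Q + P' * (Q - Q') := by ring
    rw [this]
    refine Submodule.add_mem _ (mul_mem_shifted_left hIz hJz hJ (Submodule.sub_mem _ hP hP') ?_ hQ)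
      (mul_mem_shifted_right hJz hP' (Submodule.sub_mem _ hQ hQ') ?_)
    · have := dvd_sub hPa hPa'
      simpa using this
    · have := dvd_sub hQc hQc'
      simpa using this
  | succ n ih =>
    intro a a' c c' P P' Q Q' hn ha ha' hc hc' hac hP hPa hP' hPa' hQ hQc hQ' hQc'
    have hex : ∃ i, a' i < a i := by
      by_contra! h
      have : a - a' = 0 := tsub_eq_zero_iff_le.2 h
      rw [this] at hn; simp at hn
    obtain ⟨i, hi⟩ := hex
    have hex : ∃ j, a j < a' j := by
      by_contra! h
      obtain ⟨b, rfl⟩ := le_iff_exists_add.1 (show a' ≤ a from h)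
      have hb : b = 0 := by
        refine (Finsupp.degree_eq_zero_iff _).1 ?_
        simp at ha; omega
      subst hb; simp at hi
    obtain ⟨j, hj⟩ := hex
    have hij : i ≠ j := by rintro rfl; omega
    have hcj : 1 ≤ c j := by
      have := DFunLike.congr_fun hac j
      simp at this; omega
    obtain ⟨b, rfl⟩ := le_iff_exists_add'.1
      (show Finsupp.single i 1 ≤ a by simp only [Finsupp.single_le_iff]; omega)
    obtain ⟨c₀, rfl⟩ := le_iff_exists_add'.1
      (show Finsupp.single j 1 ≤ c by simp only [Finsupp.single_le_iff]; omega)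
    have hbd : (b + Finsupp.single j 1).degree = d := by simpa using ha
    have hcd : c₀.degree = w := by simpa using hc
    obtain ⟨p, hp, hpd⟩ := hI _ hbd
    obtain ⟨q, hq, hqd⟩ := hJ c₀ hcd
    have hXi : X i * q ∈ gradedPart J (w + 1) := by
      rw [add_comm]; exact mul_mem_gradedPart (isHomogeneous_X K i) hq
    have hXj : X j * q ∈ gradedPart J (w + 1) := by
      rw [add_comm]; exact mul_mem_gradedPart (isHomogeneous_X K j) hq
    have hlift : ∀ k : σ, X z ∣ X k * q - monomial (c₀ + Finsupp.single k 1) (1 : K) := by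
      intro k
      have : X k * q - monomial (c₀ + Finsupp.single k 1) (1 : K)
          = X k * (q - monomial c₀ 1) := by
        rw [mul_sub, X, monomial_mul, one_mul, add_comm]
      rw [this]
      exact dvd_mul_of_dvd_right hqd _
    have h1 : P * (Q - X j * q) ∈ shifted I J z d w := by
      refine mul_mem_shifted_right hJz hP (Submodule.sub_mem _ hQ hXj) ?_
      have := dvd_sub hQc (hlift j)
      simpa using this
    have h2 : (X j * P - X i * p) * q ∈ shifted I J z d w := by
      have hdv : X z ∣ X j * P - X i * p := by
        have h3 : X j * P - X i * p = X j * (P - monomial (b + Finsupp.single i 1) 1)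
            - X i * (p - monomial (b + Finsupp.single j 1) 1) := by
          have : (X j : MvPolynomial σ K) * monomial (b + Finsupp.single i 1) 1
              = X i * monomial (b + Finsupp.single j 1) 1 := by
            simp only [X, monomial_mul]; ac_rfl
          linear_combination this
        rw [h3]
        exact dvd_sub (dvd_mul_of_dvd_right hPa _) (dvd_mul_of_dvd_right hpd _)
      have hm : X j * P - X i * p ∈ gradedPart I (d + 1) := by
        rw [add_comm]
        exact Submodule.sub_mem _ (mul_mem_gradedPart (isHomogeneous_X K j) hP)
          (mul_mem_gradedPart (isHomogeneous_X K i) hp)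
      obtain ⟨g, hg⟩ := hdv
      rw [hg] at hm ⊢
      exact ⟨g * q, Submodule.mul_mem_mul (X_mul_mem_gradedPart hIz hm) hq, by
        simp only [LinearMap.mulLeft_apply]; ring⟩
    have h3 : p * (X i * q) - P' * Q' ∈ shifted I J z d w := by
      refine ih (b + Finsupp.single j 1) a' (c₀ + Finsupp.single i 1) c' _ _ _ _ ?_ hbd ha'
        (by simpa using hcd) hc' (by rw [← hac]; ac_rfl) hp hpd hP' hPa' hXi (hlift i) hQ' hQc'
      have : b + Finsupp.single i 1 - a' = (b + Finsupp.single j 1 - a') + Finsupp.single i 1 := by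
        ext k
        have hi' := hi
        have hj' := hj
        simp only [Finsupp.coe_add, Pi.add_apply, Finsupp.single_eq_same] at hi'
        rw [Finsupp.add_apply, Finsupp.single_eq_of_ne hij.symm] at hj'
        by_cases hki : k = i
        · subst hki
          simp [Finsupp.single_eq_of_ne hij]; omega
        · by_cases hkj : k = j
          · subst hkj
            simp [Finsupp.single_eq_of_ne hij.symm]; omega
          · simp [Finsupp.single_eq_of_ne hki, Finsupp.single_eq_of_ne hkj]
      rw [this] at hn
      simpa using hn
    have : P * Q - P' * Q' = P * (Q - X j * q) + (X j * P - X i * p) * q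
        + (p * (X i * q) - P' * Q') := by ring
    rw [this]
    exact Submodule.add_mem _ (Submodule.add_mem _ h1 h2) h3

/-- Saturation of products: multiples of `z` in `I_d J_{w+1}` come from `I_d J_w`. -/
lemma exists_eq_X_mul_of_mem_mul {I J : Ideal (MvPolynomial σ K)} {z : σ} {d w : ℕ}
    (hIz : ∀ f, X z * f ∈ I → f ∈ I) (hJz : ∀ f, X z * f ∈ J → f ∈ J)
    (hI : LiftsMonomials I z d) (hJ : LiftsMonomials J z w) (hJ' : LiftsMonomials J z (w + 1))
    {f : MvPolynomial σ K} (hf : X z * f ∈ gradedPart I d * gradedPart J (w + 1)) :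
    f ∈ gradedPart I d * gradedPart J w := by
  classical
  choose! p hp hpd using hI
  choose! q hq hqd using hJ'
  set N := shifted I J z d w with hN
  set ψ : (σ →₀ ℕ) → MvPolynomial σ K ⧸ N := fun e =>
    if h : ∃ x : (σ →₀ ℕ) × (σ →₀ ℕ), x.1.degree = d ∧ x.2.degree = w + 1 ∧ x.1 + x.2 = e then
      N.mkQ (p h.choose.1 * q h.choose.2) else 0 with hψ
  set Ψ : MvPolynomial σ K →ₗ[K] MvPolynomial σ K ⧸ N := (basisMonomials σ K).constr K ψ with hΨ
  have Ψmon : ∀ e, Ψ (monomial e 1) = ψ e := fun e => by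
    have : (monomial e 1 : MvPolynomial σ K) = basisMonomials σ K e := by
      rw [coe_basisMonomials]
    rw [hΨ, this, Module.Basis.constr_basis]
  have ψadd : ∀ a c, a.degree = d → c.degree = w + 1 →
      ∀ P ∈ gradedPart I d, X z ∣ P - monomial a 1 → ∀ Q ∈ gradedPart J (w + 1),
      X z ∣ Q - monomial c 1 → ψ (a + c) = N.mkQ (P * Q) := by
    intro a c ha hc P hP hPa Q hQ hQc
    have h : ∃ x : (σ →₀ ℕ) × (σ →₀ ℕ), x.1.degree = d ∧ x.2.degree = w + 1 ∧
      x.1 + x.2 = a + c := ⟨(a, c), ha, hc, rfl⟩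
    simp only [hψ]
    rw [dif_pos h, ← sub_eq_zero, ← map_sub, Submodule.mkQ_apply, Submodule.Quotient.mk_eq_zero]
    obtain ⟨h1, h2, h3⟩ := h.choose_spec
    exact balanced_mem_shifted hIz hJz (fun a ha => ⟨p a, hp a ha, hpd a ha⟩) hJ _ _ _ _ _ _ _ _ _
      rfl h1 ha h2 hc h3 (hp _ h1) (hpd _ h1) hP hPa (hq _ h2) (hqd _ h2) hQ hQc
  have ψzero : ∀ e, e z ≠ 0 → ψ e = 0 := by
    intro e he
    by_cases h : ∃ x : (σ →₀ ℕ) × (σ →₀ ℕ), x.1.degree = d ∧ x.2.degree = w + 1 ∧ x.1 + x.2 = e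
    · obtain ⟨⟨a, c⟩, ha, hc, rfl⟩ := h
      simp only at ha hc
      have hdv : ∀ b : σ →₀ ℕ, b z ≠ 0 → X z ∣ (0 : MvPolynomial σ K) - monomial b 1 := by
        intro b hb
        rw [zero_sub, dvd_neg, X_dvd_monomial]
        exact Or.inr hb
      by_cases haz : a z = 0
      · have hcz : c z ≠ 0 := by simpa [haz] using he
        rw [ψadd a c ha hc (p a) (hp a ha) (hpd a ha) 0 (Submodule.zero_mem _) (hdv c hcz)]
        simp
      · rw [ψadd a c ha hc 0 (Submodule.zero_mem _) (hdv a haz) (q c) (hq c hc) (hqd c hc)]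
        simp
    · simp only [hψ]
      rw [dif_neg h]
  have expand : ∀ (I : Ideal (MvPolynomial σ K)) (t : ℕ) (p : (σ →₀ ℕ) → MvPolynomial σ K),
      (∀ a, a.degree = t → p a ∈ gradedPart I t) →
      (∀ a, a.degree = t → X z ∣ p a - monomial a 1) → ∀ P ∈ gradedPart I t,
      X z ∣ P - ∑ a ∈ P.support, coeff a P • p a ∧
      (∑ a ∈ P.support, coeff a P • p a) ∈ gradedPart I t := by
    intro I t p hp hpd P hP
    have hdeg : ∀ a ∈ P.support, a.degree = t := fun a ha =>
      degree_of_mem_support (mem_gradedPart.1 hP).2 ha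
    constructor
    · exact X_dvd_sub_sum_smul fun c hc => hpd c (hdeg c hc)
    · exact Submodule.sum_mem _ fun a ha => Submodule.smul_mem _ _ (hp a (hdeg a ha))
  have hmk : ∀ F ∈ gradedPart I d * gradedPart J (w + 1), N.mkQ F = Ψ F := by
    intro F hF
    induction hF using Submodule.mul_induction_on' with
    | mem_mul_mem P hP Q hQ =>
      obtain ⟨h1, h2⟩ := expand I d p hp hpd P hP
      obtain ⟨h3, h4⟩ := expand J (w + 1) q hq hqd Q hQ
      set P' := ∑ a ∈ P.support, coeff a P • p a
      set Q' := ∑ a ∈ Q.support, coeff a Q • q a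
      have e1 : N.mkQ (P * Q) = N.mkQ (P' * Q') := by
        rw [← sub_eq_zero, ← map_sub, Submodule.mkQ_apply, Submodule.Quotient.mk_eq_zero]
        have : P * Q - P' * Q' = (P - P') * Q + P' * (Q - Q') := by ring
        rw [this]
        exact Submodule.add_mem _
          (mul_mem_shifted_left hIz hJz hJ (Submodule.sub_mem _ hP h2) h1 hQ)
          (mul_mem_shifted_right hJz h2 (Submodule.sub_mem _ hQ h4) h3)
      have e2 : P * Q = ∑ a ∈ P.support, ∑ c ∈ Q.support,
          (coeff a P * coeff c Q) • monomial (a + c) (1 : K) := by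
        conv_lhs => rw [P.as_sum, Q.as_sum]
        rw [Finset.sum_mul_sum]
        refine Finset.sum_congr rfl fun a _ => Finset.sum_congr rfl fun c _ => ?_
        rw [monomial_mul, smul_monomial, smul_eq_mul, mul_one]
      rw [e1, e2, Finset.sum_mul_sum, map_sum, map_sum]
      refine Finset.sum_congr rfl fun a ha => ?_
      rw [map_sum, map_sum]
      refine Finset.sum_congr rfl fun c hc => ?_
      have ha' : a.degree = d := degree_of_mem_support (mem_gradedPart.1 hP).2 ha
      have hc' : c.degree = w + 1 := degree_of_mem_support (mem_gradedPart.1 hQ).2 hc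
      rw [smul_mul_smul_comm, map_smul, map_smul, Ψmon,
        ψadd a c ha' hc' (p a) (hp a ha') (hpd a ha') (q c) (hq c hc') (hqd c hc')]
    | add x hxm y hym hx hy => rw [map_add, map_add, hx, hy]
  have h0 : Ψ (X z * f) = 0 := by
    rw [as_sum (X z * f), map_sum]
    refine Finset.sum_eq_zero fun e he => ?_
    have : (monomial e (coeff e (X z * f)) : MvPolynomial σ K)
        = coeff e (X z * f) • monomial e 1 := by
      rw [smul_monomial, smul_eq_mul, mul_one]
    rw [this, map_smul, Ψmon, ψzero e, smul_zero]
    intro hez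
    refine mem_support_iff.1 he ?_
    rw [coeff_X_mul', if_neg]
    simpa using hez
  have := hmk _ hf
  rw [h0, Submodule.mkQ_apply, Submodule.Quotient.mk_eq_zero] at this
  obtain ⟨g, hg, hgf⟩ := this
  have : g = f := mul_left_cancel₀ (X_ne_zero z) hgf
  exact this ▸ hg

end Graded

section Lifting

variable {σ K : Type*} [Field K]

lemma LiftsMonomials.mul {I J L : Ideal (MvPolynomial σ K)} {z : σ} {s t : ℕ}
    (hI : LiftsMonomials I z s) (hJ : LiftsMonomials J z t) (hL : I * J ≤ L) :
    LiftsMonomials L z (s + t) := by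
  intro a ha
  obtain ⟨b, hb, hbs⟩ := Finsupp.exists_le_degree_eq a s (by omega)
  obtain ⟨c, rfl⟩ := le_iff_exists_add.1 hb
  obtain ⟨p, hp, hpd⟩ := hI b hbs
  obtain ⟨q, hq, hqd⟩ := hJ c (by simp at ha; omega)
  rw [mem_gradedPart] at hp hq
  refine ⟨p * q, mem_gradedPart.2 ⟨hL (Ideal.mul_mem_mul hp.1 hq.1), hp.2.mul hq.2⟩, ?_⟩
  have : p * q - monomial (b + c) (1 : K)
      = (p - monomial b 1) * q + monomial b 1 * (q - monomial c 1) := by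
    have : (monomial (b + c) (1 : K)) = monomial b 1 * monomial c 1 := by
      rw [monomial_mul, one_mul]
    rw [this]; ring
  rw [this]
  exact dvd_add (dvd_mul_of_dvd_left hpd _) (dvd_mul_of_dvd_right hqd _)

lemma liftsMonomials_top (z : σ) (t : ℕ) : LiftsMonomials (⊤ : Ideal (MvPolynomial σ K)) z t :=
  fun a ha => ⟨monomial a 1, mem_gradedPart.2 ⟨trivial, isHomogeneous_monomial _ ha⟩, by simp⟩

lemma LiftsMonomials.mono {I : Ideal (MvPolynomial σ K)} {z : σ} {s t : ℕ}
    (hI : LiftsMonomials I z s) (hst : s ≤ t) : LiftsMonomials I z t := by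
  obtain ⟨k, rfl⟩ := Nat.exists_eq_add_of_le hst
  exact hI.mul (liftsMonomials_top z k) Ideal.mul_le_left

lemma homogeneousSubmodule_mul_eq (a b : ℕ) :
    homogeneousSubmodule σ K a * homogeneousSubmodule σ K b = homogeneousSubmodule σ K (a + b) := by
  rw [← homogeneousSubmodule_one_pow K a, ← homogeneousSubmodule_one_pow K b, ← pow_add,
    homogeneousSubmodule_one_pow]

lemma gradedPart_add_le {I : Ideal (MvPolynomial σ K)} {z : σ}
    (hIz : ∀ f, X z * f ∈ I → f ∈ I) {d : ℕ} (hI : LiftsMonomials I z d) (k : ℕ) :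
    gradedPart I (d + k) ≤ gradedPart I d * homogeneousSubmodule σ K k := by
  induction k with
  | zero =>
    intro p hp
    rw [← mul_one p]
    exact Submodule.mul_mem_mul hp ((mem_homogeneousSubmodule _ _).2 (isHomogeneous_one σ K))
  | succ k ih =>
    refine (gradedPart_succ_le (w := d + k) hIz (hI.mono (by omega))).trans ?_
    rw [mul_comm]
    refine (mul_le_mul_left ih _).trans ?_
    rw [mul_assoc, homogeneousSubmodule_mul_eq]

lemma X_pow_mul_homogeneousComponent_mem {I J : Ideal (MvPolynomial σ K)} {z : σ}
    (hIh : ∀ f ∈ I, ∀ t, homogeneousComponent t f ∈ I)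
    (hJh : ∀ f ∈ J, ∀ t, homogeneousComponent t f ∈ J)
    (hIz : ∀ f, X z * f ∈ I → f ∈ I) {d : ℕ} (hI : LiftsMonomials I z d)
    {f : MvPolynomial σ K} (hf : f ∈ I * J) (t : ℕ) :
    X z ^ d * homogeneousComponent t f ∈ gradedPart I d * gradedPart J t := by
  induction hf using Submodule.mul_induction_on' with
  | add x _ y _ hx hy =>
    rw [map_add, mul_add]
    exact Submodule.add_mem _ hx hy
  | mem_mul_mem p hp q hq =>
    have hpq : p * q = ∑ k ∈ Finset.range (p.totalDegree + 1),
        ∑ l ∈ Finset.range (q.totalDegree + 1),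
          homogeneousComponent k p * homogeneousComponent l q := by
      rw [← Finset.sum_mul_sum, sum_homogeneousComponent, sum_homogeneousComponent]
    rw [hpq, map_sum, Finset.mul_sum]
    refine Submodule.sum_mem _ fun k _ => ?_
    rw [map_sum, Finset.mul_sum]
    refine Submodule.sum_mem _ fun l _ => ?_
    rw [homogeneousComponent_of_mem (m := t) (n := k + l) ((homogeneousComponent_isHomogeneous k p).mul
      (homogeneousComponent_isHomogeneous l q))]
    split_ifs with h
    · subst h
      rw [← mul_assoc]
      have h1 : X z ^ d * homogeneousComponent k p ∈
          gradedPart I d * homogeneousSubmodule σ K k := by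
        refine gradedPart_add_le hIz hI k ?_
        refine mul_mem_gradedPart ?_ (mem_gradedPart.2 ⟨hIh p hp k,
          homogeneousComponent_isHomogeneous k p⟩)
        simpa using (isHomogeneous_X K z).pow d
      have h2 : homogeneousComponent l q ∈ gradedPart J l :=
        mem_gradedPart.2 ⟨hJh q hq l, homogeneousComponent_isHomogeneous l q⟩
      have h3 := Submodule.mul_mem_mul h1 h2
      rw [mul_assoc] at h3
      refine (mul_le_mul_right (Submodule.mul_le.2 fun m hm n hn => ?_) _ : _ ≤ _) h3
      exact mul_mem_gradedPart hm hn
    · simp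

end Lifting

section Points

variable {K : Type} [Field K]

/-- The ideal of forms vanishing to order `m` at each of the points `v j`. -/
def fatIdeal {n : ℕ} (v : Fin n → Fin 4 → K) (m : ℕ) : Ideal (MvPolynomial (Fin 4) K) :=
  ⨅ j, pointIdeal K (v j) ^ m

lemma mem_fatIdeal {n : ℕ} {v : Fin n → Fin 4 → K} {m : ℕ} {f : MvPolynomial (Fin 4) K} :
    f ∈ fatIdeal v m ↔ ∀ j, f ∈ pointIdeal K (v j) ^ m := by
  simp [fatIdeal]

lemma eval_eq_zero_of_mem_pointIdeal {v : Fin 4 → K} {f : MvPolynomial (Fin 4) K}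
    (hf : f ∈ pointIdeal K v) : eval v f = 0 := by
  have : pointIdeal K v ≤ RingHom.ker (eval v) := by
    rw [pointIdeal, Ideal.span_le]
    exact fun f hf => hf.2
  exact this hf

lemma homogeneousComponent_mem_fatIdeal {n : ℕ} {v : Fin n → Fin 4 → K} {m : ℕ}
    {f : MvPolynomial (Fin 4) K} (hf : f ∈ fatIdeal v m) (t : ℕ) :
    homogeneousComponent t f ∈ fatIdeal v m := by
  let _ := gradedAlgebra (σ := Fin 4) (R := K)
  have h : ∀ w : Fin 4 → K,
      (pointIdeal K w).IsHomogeneous (homogeneousSubmodule (Fin 4) K) := fun w =>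
    Ideal.homogeneous_span _ _ fun f hf => ⟨1, hf.1⟩
  have hpow : ∀ (w : Fin 4 → K) (m : ℕ),
      (pointIdeal K w ^ m).IsHomogeneous (homogeneousSubmodule (Fin 4) K) := by
    intro w m
    induction m with
    | zero => rw [pow_zero, Ideal.one_eq_top]; exact Ideal.IsHomogeneous.top _
    | succ m ih => rw [pow_succ]; exact ih.mul (h w)
  exact homogeneousComponent_mem_of_mem (Ideal.IsHomogeneous.iInf fun j => hpow (v j) m) hf t

lemma mem_pointIdeal_of_eval_eq_zero {v : Fin 4 → K} (hv : v 0 ≠ 0)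
    {f : MvPolynomial (Fin 4) K} {t : ℕ} (hf : f.IsHomogeneous t) (h0 : eval v f = 0) :
    f ∈ pointIdeal K v := by
  set c : Fin 4 → K := fun i => v i / v 0 with hc
  set φ : MvPolynomial (Fin 4) K →ₐ[K] MvPolynomial (Fin 4) K :=
    aeval fun i => C (c i) * X 0 with hφ
  have h1 : (Ideal.Quotient.mkₐ K (pointIdeal K v)).comp φ
      = Ideal.Quotient.mkₐ K (pointIdeal K v) := by
    refine algHom_ext fun i => ?_
    simp only [AlgHom.comp_apply, hφ, aeval_X, Ideal.Quotient.mkₐ_eq_mk]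
    rw [Ideal.Quotient.eq]
    refine Ideal.subset_span ⟨?_, ?_⟩
    · exact ((isHomogeneous_C_mul_X _ _).sub (isHomogeneous_X _ _))
    · simp [hc, hv]
  have h2 : φ f = 0 := by
    have e1 : φ f = C (eval c f) * X 0 ^ t := by
      have : ∀ a ∈ f.support, φ (monomial a (coeff a f))
          = C (eval c (monomial a (coeff a f))) * X 0 ^ t := by
        intro a ha
        have hd := degree_of_mem_support hf ha
        rw [hφ, aeval_monomial, eval_monomial, C_mul, Finsupp.prod, Finsupp.prod, ← hd,
          Finsupp.degree]
        simp only [mul_pow, Finset.prod_mul_distrib, Finset.prod_pow_eq_pow_sum, map_prod,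
          C_pow, algebraMap_eq, mul_assoc]
        rfl
      conv_lhs => rw [as_sum f, map_sum, Finset.sum_congr rfl this]
      conv_rhs => rw [as_sum f, map_sum]
      rw [map_sum, Finset.sum_mul]
    have e2 : eval v f = v 0 ^ t * eval c f := by
      have hvc : v = fun i => v 0 * c i := by
        funext i; simp [hc]; field_simp
      conv_lhs => rw [hvc, as_sum f]
      conv_rhs => rw [as_sum f]
      rw [map_sum, map_sum, Finset.mul_sum]
      refine Finset.sum_congr rfl fun a ha => ?_
      have hd := degree_of_mem_support hf ha
      rw [eval_monomial, eval_monomial, Finsupp.prod, Finsupp.prod, ← hd, Finsupp.degree]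
      simp only [mul_pow, Finset.prod_mul_distrib, Finset.prod_pow_eq_pow_sum]
      change _ * (v 0 ^ (∑ i ∈ a.support, a i) * _) = v 0 ^ (∑ i ∈ a.support, a i) * _
      ring
    have : eval c f = 0 := by
      rw [h0] at e2
      exact (mul_eq_zero.1 e2.symm).resolve_left (pow_ne_zero _ hv)
    rw [e1, this]; simp
  have := congrArg (fun g => g f) h1
  simp only [AlgHom.comp_apply, h2, map_zero, Ideal.Quotient.mkₐ_eq_mk] at this
  exact Ideal.Quotient.eq_zero_iff_mem.1 this.symm

end Points

section MonomialIdeals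

variable {σ K : Type*} [Field K]

lemma monomial_mem_span_X_pow (S : Finset σ) (a : σ →₀ ℕ) (c : K) {r : ℕ}
    (h : r ≤ ∑ i ∈ S, a i) :
    monomial a c ∈ (Ideal.span (X '' (S : Set σ)) : Ideal (MvPolynomial σ K)) ^ r := by
  classical
  refine Ideal.pow_le_pow_right h ?_
  have hdvd : ∏ i ∈ S, (X i : MvPolynomial σ K) ^ a i ∣ monomial a c := by
    rw [monomial_eq, Finsupp.prod]
    refine dvd_mul_of_dvd_right ?_ _
    rw [Finset.prod_subset (Finset.subset_union_left (s₁ := a.support) (s₂ := S))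
      (f := fun i => (X i : MvPolynomial σ K) ^ a i) fun i _ hi => by
        rw [Finsupp.notMem_support_iff.1 hi, pow_zero]]
    exact Finset.prod_dvd_prod_of_subset _ _ _ Finset.subset_union_right
  refine Ideal.mem_of_dvd _ hdvd ?_
  rw [← Finset.prod_pow_eq_pow_sum]
  exact Ideal.prod_mem_prod fun i hi => Ideal.pow_mem_pow
    (Ideal.subset_span (Set.mem_image_of_mem _ hi)) _

lemma mem_span_X_pow_iff (S : Finset σ) {f : MvPolynomial σ K} {r : ℕ} :
    f ∈ (Ideal.span (X '' (S : Set σ)) : Ideal (MvPolynomial σ K)) ^ r ↔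
      ∀ a ∈ f.support, r ≤ ∑ i ∈ S, a i := by
  classical
  constructor
  · have key : (Ideal.span (X '' (S : Set σ)) : Ideal (MvPolynomial σ K)) ^ r ≤
        Ideal.span ((fun a => monomial a (1 : K)) '' {a | r ≤ ∑ i ∈ S, a i}) := by
      induction r with
      | zero =>
        rw [pow_zero, Ideal.one_eq_top]
        exact top_le_iff.2 ((Ideal.eq_top_iff_one _).2 (Ideal.subset_span ⟨0, by simp, by simp⟩))
      | succ r ih =>
        rw [pow_succ]
        refine (Ideal.mul_mono_left ih).trans ?_
        rw [Ideal.span_mul_span', Ideal.span_le]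
        rintro _ ⟨_, ⟨a, ha, rfl⟩, _, ⟨i, hi, rfl⟩, rfl⟩
        refine Ideal.subset_span ⟨a + Finsupp.single i 1, ?_, ?_⟩
        · have : ∑ j ∈ S, (Finsupp.single i 1 : σ →₀ ℕ) j = 1 := by
            rw [Finset.sum_eq_single_of_mem i hi fun j _ hj => Finsupp.single_eq_of_ne hj]
            simp
          simp only [Set.mem_ofPred_eq, Finsupp.coe_add, Pi.add_apply, Finset.sum_add_distrib,
            this]
          simpa using ha
        · simp [X, monomial_mul]
    intro hf a ha
    obtain ⟨s, hs, hsa⟩ := mem_ideal_span_monomial_image.1 (key hf) a ha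
    exact le_trans hs (Finset.sum_le_sum fun i _ => hsa i)
  · intro h
    rw [as_sum f]
    exact Submodule.sum_mem _ fun a ha => monomial_mem_span_X_pow S a _ (h a ha)

lemma mem_span_X_pow_of_X_mul_mem {S : Finset σ} {z : σ} (hz : z ∉ S) {f : MvPolynomial σ K}
    {r : ℕ} (h : X z * f ∈ (Ideal.span (X '' (S : Set σ)) : Ideal (MvPolynomial σ K)) ^ r) :
    f ∈ (Ideal.span (X '' (S : Set σ)) : Ideal (MvPolynomial σ K)) ^ r := by
  rw [mem_span_X_pow_iff] at h ⊢
  intro a ha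
  have := h (Finsupp.single z 1 + a) (by
    rw [mem_support_iff, coeff_X_mul]; exact mem_support_iff.1 ha)
  have h0 : ∑ j ∈ S, (Finsupp.single z 1 : σ →₀ ℕ) j = 0 :=
    Finset.sum_eq_zero fun j hj => Finsupp.single_eq_of_ne fun e => hz (e ▸ hj)
  simpa only [Finsupp.coe_add, Pi.add_apply, Finset.sum_add_distrib, h0, zero_add] using this

end MonomialIdeals

section LinearSubstitution

variable {K : Type} [Field K]

/-- The substitution `f(x) ↦ f(A x)`. -/
def linSubst (A : Matrix (Fin 4) (Fin 4) K) :
    MvPolynomial (Fin 4) K →ₐ[K] MvPolynomial (Fin 4) K :=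
  aeval fun i => ∑ k, C (A i k) * X k

lemma linSubst_linSubst (A B : Matrix (Fin 4) (Fin 4) K) (f : MvPolynomial (Fin 4) K) :
    linSubst A (linSubst B f) = linSubst (B * A) f := by
  have : (linSubst A).comp (linSubst B) = linSubst (B * A) := by
    refine algHom_ext fun i => ?_
    simp only [linSubst, AlgHom.comp_apply, aeval_X, map_sum, map_mul, Matrix.mul_apply,
      Finset.sum_mul, algHom_C, algebraMap_eq, Finset.mul_sum]
    rw [Finset.sum_comm]
    simp only [mul_assoc]
  exact DFunLike.congr_fun this f

lemma linSubst_one (f : MvPolynomial (Fin 4) K) : linSubst 1 f = f := by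
  have : linSubst (1 : Matrix (Fin 4) (Fin 4) K) = AlgHom.id K _ := by
    refine algHom_ext fun i => ?_
    simp [linSubst, Matrix.one_apply]
  rw [this]; rfl

lemma isHomogeneous_linSubst (A : Matrix (Fin 4) (Fin 4) K) {f : MvPolynomial (Fin 4) K}
    {t : ℕ} (hf : f.IsHomogeneous t) : (linSubst A f).IsHomogeneous t := by
  have := hf.aeval (n := 1) (fun i => ∑ k, C (A i k) * X k) fun i =>
    IsHomogeneous.sum _ _ _ fun k _ => isHomogeneous_C_mul_X _ _
  rwa [one_mul] at this

lemma eval_linSubst (A : Matrix (Fin 4) (Fin 4) K) (f : MvPolynomial (Fin 4) K)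
    (w : Fin 4 → K) : eval w (linSubst A f) = eval (A.mulVec w) f := by
  have : (aeval w).comp (linSubst A) = (aeval (A.mulVec w) : _ →ₐ[K] K) := by
    refine algHom_ext fun i => ?_
    simp [linSubst, Matrix.mulVec, dotProduct]
  exact DFunLike.congr_fun this f

lemma linSubst_mem_pointIdeal_pow {A : Matrix (Fin 4) (Fin 4) K} {v w : Fin 4 → K}
    (hv : A.mulVec w = v) {f : MvPolynomial (Fin 4) K} {r : ℕ} (hf : f ∈ pointIdeal K v ^ r) :
    linSubst A f ∈ pointIdeal K w ^ r := by
  have h : (pointIdeal K v).map (linSubst A) ≤ pointIdeal K w := by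
    rw [pointIdeal, Ideal.map_span, Ideal.span_le]
    rintro _ ⟨f, hf, rfl⟩
    refine Ideal.subset_span ⟨isHomogeneous_linSubst A hf.1, ?_⟩
    rw [eval_linSubst, hv, hf.2]
  have := Ideal.mem_map_of_mem (linSubst A) hf
  rw [Ideal.map_pow] at this
  exact Ideal.pow_right_mono h r this

lemma linSubst_mem_pointIdeal_pow_iff {A : Matrix (Fin 4) (Fin 4) K} (hA : IsUnit A.det)
    {v w : Fin 4 → K} (hv : A.mulVec w = v) {f : MvPolynomial (Fin 4) K} {r : ℕ} :
    linSubst A f ∈ pointIdeal K w ^ r ↔ f ∈ pointIdeal K v ^ r := by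
  refine ⟨fun h => ?_, linSubst_mem_pointIdeal_pow hv⟩
  have := linSubst_mem_pointIdeal_pow (A := A⁻¹) (v := w) (w := v)
    (by rw [← hv, Matrix.mulVec_mulVec, Matrix.nonsing_inv_mul _ hA, Matrix.one_mulVec]) h
  rwa [linSubst_linSubst, Matrix.mul_nonsing_inv _ hA, linSubst_one] at this

lemma pointIdeal_single (k : Fin 4) :
    pointIdeal K (Pi.single k 1) = Ideal.span (X '' ((Finset.univ.erase k : Finset (Fin 4)) :
      Set (Fin 4))) := by
  apply le_antisymm
  · rw [pointIdeal, Ideal.span_le]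
    rintro f ⟨hf, h0⟩
    rw [SetLike.mem_coe, ← pow_one (Ideal.span _), mem_span_X_pow_iff]
    intro a ha
    have hd := degree_of_mem_support hf ha
    rw [Finsupp.degree_eq_sum, ← Finset.add_sum_erase _ _ (Finset.mem_univ k)] at hd
    by_contra hcon
    have hs : ∑ i ∈ Finset.univ.erase k, a i = 0 := by omega
    have hak : a = Finsupp.single k 1 := by
      ext i
      by_cases hik : i = k
      · subst hik; simp; omega
      · rw [Finsupp.single_eq_of_ne hik]
        exact Finset.sum_eq_zero_iff.1 hs i (by simp [hik])
    rw [mem_support_iff] at ha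
    apply ha
    rw [← h0, eval_eq', hak]
    rw [Finset.sum_eq_single (Finsupp.single k 1)]
    · rw [Finset.prod_eq_one]
      · simp
      · intro i _
        by_cases hik : i = k
        · subst hik; simp
        · simp [Finsupp.single_eq_of_ne hik]
    · intro b hb hbk
      have hdb := degree_of_mem_support hf hb
      rw [Finsupp.degree_eq_sum, ← Finset.add_sum_erase _ _ (Finset.mem_univ k)] at hdb
      have : ∃ i ≠ k, b i ≠ 0 := by
        by_contra! hcon
        apply hbk
        ext i
        by_cases hik : i = k
        · subst hik
          have : ∑ j ∈ Finset.univ.erase i, b j = 0 :=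
            Finset.sum_eq_zero fun j hj => hcon j (Finset.ne_of_mem_erase hj)
          simp; omega
        · rw [Finsupp.single_eq_of_ne hik, hcon i hik]
      obtain ⟨i, hik, hbi⟩ := this
      rw [Finset.prod_eq_zero (Finset.mem_univ i), mul_zero]
      rw [Pi.single_eq_of_ne hik, zero_pow hbi]
    · intro h
      rw [notMem_support_iff.1 h, zero_mul]
  · rw [Ideal.span_le]
    rintro _ ⟨i, hi, rfl⟩
    refine Ideal.subset_span ⟨isHomogeneous_X _ _, ?_⟩
    rw [eval_X, Pi.single_eq_of_ne (Finset.ne_of_mem_erase hi)]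

lemma mem_pointIdeal_pow_of_X_zero_mul_mem {v : Fin 4 → K} (hv : v 0 ≠ 0)
    {f : MvPolynomial (Fin 4) K} {r : ℕ} (h : X 0 * f ∈ pointIdeal K v ^ r) :
    f ∈ pointIdeal K v ^ r := by
  set A : Matrix (Fin 4) (Fin 4) K := (1 : Matrix (Fin 4) (Fin 4) K).updateCol 0 v with hA
  have hdet : IsUnit A.det := by
    have : A.det = v 0 := by
      rw [hA, ← Matrix.cramer_apply, Matrix.cramer_one]; rfl
    rw [this]; exact hv.isUnit
  have hAv : A.mulVec (Pi.single 0 1) = v := by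
    ext i
    simp [hA]
  rw [← linSubst_mem_pointIdeal_pow_iff hdet hAv, pointIdeal_single] at h ⊢
  have hX : linSubst A (X 0) = C (v 0) * X 0 := by
    simp [linSubst, hA, Matrix.updateCol_apply, Fin.sum_univ_succ]
  rw [map_mul, hX] at h
  refine mem_span_X_pow_of_X_mul_mem (z := 0) (by simp) ?_
  have := Ideal.mul_mem_left _ (C (v 0)⁻¹) h
  rwa [← mul_assoc, ← mul_assoc, ← C_mul, inv_mul_cancel₀ hv, C_1, one_mul] at this

end LinearSubstitution

section Structure

variable {K : Type} [Field K] {n : ℕ} {v : Fin n → Fin 4 → K}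

lemma fatIdeal_zero : fatIdeal v 0 = ⊤ := by
  simp [fatIdeal]

lemma fatIdeal_one : fatIdeal v 1 = ⨅ j, pointIdeal K (v j) := by
  simp [fatIdeal]

lemma fatIdeal_anti {a b : ℕ} (h : a ≤ b) : fatIdeal v b ≤ fatIdeal v a :=
  iInf_mono fun _ => Ideal.pow_le_pow_right h

lemma fatIdeal_mul_le (a b : ℕ) : fatIdeal v a * fatIdeal v b ≤ fatIdeal v (a + b) := by
  refine le_iInf fun j => ?_
  rw [pow_add]
  exact Ideal.mul_mono (iInf_le _ j) (iInf_le _ j)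

lemma fatIdeal_one_pow_le (r : ℕ) : fatIdeal v 1 ^ r ≤ fatIdeal v r := by
  induction r with
  | zero => rw [fatIdeal_zero]; exact le_top
  | succ r ih =>
    rw [pow_succ]
    exact (Ideal.mul_mono_left ih).trans (fatIdeal_mul_le r 1)

/-- Forms of degree `s` that restrict to the coordinate functions on the points `v j`. -/
def IsDualFamily (v : Fin n → Fin 4 → K) (s : ℕ) (u : Fin n → MvPolynomial (Fin 4) K) : Prop :=
  (∀ j, (u j).IsHomogeneous s) ∧ ∀ i j, eval (v i) (u j) = if i = j then 1 else 0

variable {s : ℕ} {u : Fin n → MvPolynomial (Fin 4) K}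

lemma mem_fatIdeal_of_X_zero_mul_mem (hv : ∀ j, v j 0 ≠ 0) {r : ℕ}
    (f : MvPolynomial (Fin 4) K) (h : X 0 * f ∈ fatIdeal v r) : f ∈ fatIdeal v r := by
  rw [mem_fatIdeal] at h ⊢
  exact fun j => mem_pointIdeal_pow_of_X_zero_mul_mem (hv j) (h j)

lemma liftsMonomials_fatIdeal_one (hv : ∀ j, v j 0 ≠ 0) (hu : IsDualFamily v s u) :
    LiftsMonomials (fatIdeal v 1) 0 (s + 1) := by
  intro a ha
  set q : MvPolynomial (Fin 4) K :=
    ∑ j, C (eval (v j) (monomial a 1) / v j 0) * (X 0 * u j) with hq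
  have hqh : q.IsHomogeneous (s + 1) := by
    refine IsHomogeneous.sum _ _ _ fun j _ => ?_
    refine IsHomogeneous.C_mul ?_ _
    rw [add_comm]
    exact (isHomogeneous_X _ _).mul (hu.1 j)
  have hp : (monomial a 1 - q).IsHomogeneous (s + 1) := (isHomogeneous_monomial _ ha).sub hqh
  refine ⟨monomial a 1 - q, mem_gradedPart.2 ⟨?_, hp⟩, ?_⟩
  · rw [mem_fatIdeal]
    intro i
    rw [pow_one]
    refine mem_pointIdeal_of_eval_eq_zero (hv i) hp ?_
    simp [hq, hu.2, hv]
  · rw [sub_sub_cancel_left, dvd_neg]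
    exact Finset.dvd_sum fun j _ => dvd_mul_of_dvd_right (dvd_mul_right _ _) _

lemma liftsMonomials_fatIdeal (hv : ∀ j, v j 0 ≠ 0) (hu : IsDualFamily v s u) (r : ℕ) :
    LiftsMonomials (fatIdeal v r) 0 (r * (s + 1)) := by
  induction r with
  | zero => rw [fatIdeal_zero]; exact liftsMonomials_top _ _
  | succ r ih =>
    rw [Nat.succ_mul]
    exact ih.mul (liftsMonomials_fatIdeal_one hv hu) (fatIdeal_mul_le r 1)

lemma exists_X_zero_pow_mul_mem (hv : ∀ j, v j 0 ≠ 0) (hu : IsDualFamily v s u)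
    {r : ℕ} {f : MvPolynomial (Fin 4) K} (hf : f ∈ fatIdeal v r) :
    ∃ N, X 0 ^ N * f ∈ fatIdeal v 1 ^ r := by
  set Q : Ideal (MvPolynomial (Fin 4) K) :=
    Submodule.comap (LinearMap.toSpanSingleton _ _ f) (fatIdeal v 1 ^ r) with hQ
  have memQ : ∀ h, h ∈ Q ↔ h * f ∈ fatIdeal v 1 ^ r := fun h => Iff.rfl
  have hIQ : fatIdeal v 1 ≤ Q.radical := fun h hh => ⟨r, by
    rw [memQ]
    exact Ideal.mul_mem_right _ _ (Ideal.pow_mem_pow hh r)⟩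
  have huQ : ∀ j, u j ∈ Q.radical := by
    refine fun j => ⟨r, ?_⟩
    rw [memQ]
    have h1 : Ideal.span {u j} * pointIdeal K (v j) ≤ fatIdeal v 1 := by
      rw [Ideal.span_singleton_mul_le_iff]
      intro g hg
      rw [mem_fatIdeal]
      intro i
      rw [pow_one]
      by_cases hij : i = j
      · subst hij; exact Ideal.mul_mem_left _ _ hg
      · refine Ideal.mul_mem_right _ _ (mem_pointIdeal_of_eval_eq_zero (hv i) (hu.1 j) ?_)
        rw [hu.2, if_neg hij]
    refine Ideal.pow_right_mono h1 r ?_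
    rw [mul_pow]
    exact Ideal.mul_mem_mul (Ideal.pow_mem_pow (Ideal.mem_span_singleton_self _) r)
      (mem_fatIdeal.1 hf j)
  have hdiff : X 0 ^ s - ∑ j, C (v j 0 ^ s) * u j ∈ fatIdeal v 1 := by
    rw [mem_fatIdeal]
    intro i
    rw [pow_one]
    refine mem_pointIdeal_of_eval_eq_zero (t := s) (hv i) (IsHomogeneous.sub ?_ ?_) ?_
    · exact isHomogeneous_X_pow _ _
    · exact IsHomogeneous.sum _ _ _ fun j _ => (hu.1 j).C_mul _
    · simp [hu.2]
  have hX : X 0 ^ s ∈ Q.radical := by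
    have := Ideal.add_mem _ (hIQ hdiff)
      (Ideal.sum_mem _ (t := Finset.univ) fun j _ => Ideal.mul_mem_left _ (C (v j 0 ^ s)) (huQ j))
    rwa [sub_add_cancel] at this
  obtain ⟨N, hN⟩ := hX
  refine ⟨s * N, ?_⟩
  rwa [memQ, ← pow_mul] at hN

lemma mem_mul_of_X_pow_mul_mem (hv : ∀ j, v j 0 ≠ 0) (hu : IsDualFamily v s u) {r w : ℕ}
    (hw : r * (s + 1) ≤ w) (k : ℕ) {f : MvPolynomial (Fin 4) K}
    (hf : X 0 ^ k * f ∈ gradedPart (fatIdeal v 1) (s + 1) * gradedPart (fatIdeal v r) (w + k)) :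
    f ∈ gradedPart (fatIdeal v 1) (s + 1) * gradedPart (fatIdeal v r) w := by
  induction k with
  | zero => simpa using hf
  | succ k ih =>
    refine ih ?_
    rw [pow_succ', mul_assoc, ← add_assoc] at hf
    have hl := liftsMonomials_fatIdeal hv hu r
    exact exists_eq_X_mul_of_mem_mul (mem_fatIdeal_of_X_zero_mul_mem hv)
      (mem_fatIdeal_of_X_zero_mul_mem hv) (liftsMonomials_fatIdeal_one hv hu)
      (hl.mono (by omega)) (hl.mono (by omega)) hf

theorem gradedPart_fatIdeal_le (hv : ∀ j, v j 0 ≠ 0) (hu : IsDualFamily v s u) (r : ℕ) {t : ℕ}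
    (ht : r * (s + 1) ≤ t) :
    gradedPart (fatIdeal v r) t ≤
      gradedPart (fatIdeal v 1) (s + 1) ^ r * homogeneousSubmodule (Fin 4) K (t - r * (s + 1)) := by
  induction r generalizing t with
  | zero =>
    intro f hf
    simpa using hf.2
  | succ r ih =>
    intro f hf
    rw [Nat.succ_mul] at ht
    have hsub : r * (s + 1) ≤ t - (s + 1) := by omega
    obtain ⟨N, hN⟩ := exists_X_zero_pow_mul_mem hv hu (mem_gradedPart.1 hf).1
    rw [pow_succ'] at hN
    have h1 := X_pow_mul_homogeneousComponent_mem (z := 0)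
      (fun f hf t => homogeneousComponent_mem_fatIdeal hf t)
      (fun f hf t => homogeneousComponent_mem_fatIdeal hf t)
      (mem_fatIdeal_of_X_zero_mul_mem hv) (liftsMonomials_fatIdeal_one hv hu)
      (Ideal.mul_mono_right (fatIdeal_one_pow_le r) hN) (N + t)
    rw [homogeneousComponent_of_mem (n := N + t)
      ((isHomogeneous_X_pow 0 N).mul (mem_gradedPart.1 hf).2), if_pos rfl, ← mul_assoc, ← pow_add,
      show N + t = t - (s + 1) + (s + 1 + N) by omega] at h1
    have h2 := mem_mul_of_X_pow_mul_mem hv hu hsub _ h1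
    have h3 := (mul_le_mul_right (ih hsub) _ : _ ≤ _) h2
    rwa [pow_succ', mul_assoc,
      show t - (r + 1) * (s + 1) = t - (s + 1) - r * (s + 1) by rw [Nat.succ_mul]; omega]

lemma mem_irrIdeal_pow {f : MvPolynomial (Fin 4) K} {q t : ℕ} (hf : f.IsHomogeneous t)
    (hq : q ≤ t) : f ∈ irrIdeal K ^ q := by
  rw [irrIdeal, ← Set.image_univ, ← Finset.coe_univ, mem_span_X_pow_iff]
  intro a ha
  rw [← Finsupp.degree_eq_sum, degree_of_mem_support hf ha]
  exact hq

theorem fatIdeal_le_of_degree_bound (hv : ∀ j, v j 0 ≠ 0) (hu : IsDualFamily v s u) {r m q : ℕ}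
    (hrm : r ≤ m)
    (hdeg : ∀ t, ∀ f ∈ gradedPart (fatIdeal v m) t, f ≠ 0 → r * (s + 1) + q ≤ t) :
    fatIdeal v m ≤ irrIdeal K ^ q * fatIdeal v 1 ^ r := by
  have hpow : ∀ r, gradedPart (fatIdeal v 1) (s + 1) ^ r ≤
      (fatIdeal v 1 ^ r).restrictScalars K := by
    intro r
    induction r with
    | zero => intro f _; simp
    | succ r ih =>
      rw [pow_succ, pow_succ]
      exact Submodule.mul_le.2 fun p hp q hq => Ideal.mul_mem_mul (ih hp) hq.1
  intro f hf
  rw [← sum_homogeneousComponent f]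
  refine Submodule.sum_mem _ fun t _ => ?_
  by_cases h0 : homogeneousComponent t f = 0
  · rw [h0]; exact Submodule.zero_mem _
  have hmem := homogeneousComponent_mem_fatIdeal hf t
  have hhom := homogeneousComponent_isHomogeneous t f
  have ht := hdeg t _ (mem_gradedPart.2 ⟨hmem, hhom⟩) h0
  have h1 := gradedPart_fatIdeal_le hv hu r (t := t) (by omega)
    (mem_gradedPart.2 ⟨fatIdeal_anti hrm hmem, hhom⟩)
  have h2 : gradedPart (fatIdeal v 1) (s + 1) ^ r *
      homogeneousSubmodule (Fin 4) K (t - r * (s + 1)) ≤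
      (irrIdeal K ^ q * fatIdeal v 1 ^ r).restrictScalars K := by
    refine Submodule.mul_le.2 fun a ha b hb => ?_
    rw [mul_comm a b]
    exact Ideal.mul_mem_mul (mem_irrIdeal_pow hb (by omega)) (hpow r ha)
  exact h2 h1

end Structure

section FirstPower

variable {K : Type} [Field K] {n : ℕ} {v : Fin n → Fin 4 → K}

lemma pderiv_mem_pointIdeal {w : Fin 4 → K} {f : MvPolynomial (Fin 4) K}
    (hf : f ∈ pointIdeal K w ^ 2) (i : Fin 4) : pderiv i f ∈ pointIdeal K w := by
  rw [pow_two] at hf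
  induction hf using Submodule.mul_induction_on' with
  | add x _ y _ hx hy => rw [map_add]; exact Ideal.add_mem _ hx hy
  | mem_mul_mem p hp q hq =>
    rw [Derivation.leibniz, smul_eq_mul, smul_eq_mul]
    exact Ideal.add_mem _ (Ideal.mul_mem_right _ _ hp) (Ideal.mul_mem_right _ _ hq)

lemma fatIdeal_two_le [CharZero K] (hn : 1 ≤ n) :
    fatIdeal v 2 ≤ irrIdeal K * fatIdeal v 1 := by
  intro f hf
  rw [← sum_homogeneousComponent f]
  refine Submodule.sum_mem _ fun t _ => ?_
  have hmem := homogeneousComponent_mem_fatIdeal hf t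
  have hhom := homogeneousComponent_isHomogeneous t f
  set g := homogeneousComponent t f
  rcases Nat.eq_zero_or_pos t with rfl | ht
  · have hC := (totalDegree_zero_iff_isHomogeneous _).2 hhom
    rw [totalDegree_eq_zero_iff_eq_C] at hC
    have h0 := eval_eq_zero_of_mem_pointIdeal
      (Ideal.pow_le_self two_ne_zero (mem_fatIdeal.1 hmem ⟨0, hn⟩))
    rw [hC, eval_C] at h0
    rw [hC, h0, C_0]
    exact Submodule.zero_mem _
  · have htK : (t : K) ≠ 0 := Nat.cast_ne_zero.2 ht.ne'
    have hg : g = C (t : K)⁻¹ * ∑ i, X i * pderiv i g := by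
      rw [hhom.sum_X_mul_pderiv, nsmul_eq_mul, ← C_eq_coe_nat, ← mul_assoc, ← C_mul,
        inv_mul_cancel₀ htK, C_1, one_mul]
    rw [hg]
    refine Ideal.mul_mem_left _ _ (Submodule.sum_mem _ fun i _ => ?_)
    refine Ideal.mul_mem_mul (Ideal.subset_span ⟨i, rfl⟩) ?_
    rw [mem_fatIdeal]
    intro j
    rw [pow_one]
    exact pderiv_mem_pointIdeal (mem_fatIdeal.1 hmem j) i

end FirstPower

section FewPoints

variable {K : Type} [Field K]

lemma monomial_mem_irrIdeal_mul_of_le {I : Ideal (MvPolynomial (Fin 4) K)} {a b : Fin 4 →₀ ℕ}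
    {r q : ℕ} (hba : b ≤ a) (hb : monomial b 1 ∈ I ^ r) (hq : b.degree + q ≤ a.degree) (c : K) :
    monomial a c ∈ irrIdeal K ^ q * I ^ r := by
  obtain ⟨e, rfl⟩ := le_iff_exists_add.1 hba
  have : monomial (b + e) c = monomial e c * monomial b 1 := by
    rw [monomial_mul, add_comm, mul_one]
  rw [this]
  refine Ideal.mul_mem_mul (mem_irrIdeal_pow (isHomogeneous_monomial c rfl) ?_) hb
  rw [map_add] at hq
  omega

lemma monomial_mem_of_linear {I : Ideal (MvPolynomial (Fin 4) K)} {S : Finset (Fin 4)}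
    (hS : ∀ l ∈ S, (X l : MvPolynomial (Fin 4) K) ∈ I) {a : Fin 4 →₀ ℕ} {r q : ℕ}
    (hr : r ≤ ∑ l ∈ S, a l) (hq : r + q ≤ a.degree) (c : K) :
    monomial a c ∈ irrIdeal K ^ q * I ^ r := by
  classical
  have hdeg : ∑ l ∈ S, a l = (a.filter (· ∈ S)).degree := by
    rw [Finsupp.degree_eq_sum]
    simp [Finsupp.filter_apply]
  obtain ⟨b, hb, hbr⟩ := Finsupp.exists_le_degree_eq (a.filter (· ∈ S)) r (hdeg ▸ hr)
  refine monomial_mem_irrIdeal_mul_of_le (b := b)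
    (hb.trans fun i => by rw [Finsupp.filter_apply]; split_ifs <;> simp) ?_ (by omega) c
  have hle : Ideal.span (X '' (S : Set (Fin 4))) ≤ I := by
    rw [Ideal.span_le]
    rintro _ ⟨l, hl, rfl⟩
    exact hS l hl
  refine Ideal.pow_right_mono hle r (monomial_mem_span_X_pow S b 1 (le_of_eq ?_))
  rw [← hbr, Finsupp.degree_eq_sum]
  symm
  refine Finset.sum_subset (Finset.subset_univ _) fun i _ hi => ?_
  have := hb i
  rw [Finsupp.filter_apply_neg _ _ hi] at this
  omega

lemma monomial_mem_of_pair {I : Ideal (MvPolynomial (Fin 4) K)} {S : Finset (Fin 4)}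
    (hS : ∀ l ∈ S, (X l : MvPolynomial (Fin 4) K) ∈ I) {i j : Fin 4} (hij : i ≠ j)
    (hi : i ∉ S) (hj : j ∉ S) (hI : (X i * X j : MvPolynomial (Fin 4) K) ∈ I)
    {a : Fin 4 →₀ ℕ} {k q : ℕ} (hki : k ≤ a i) (hkj : k ≤ a j)
    (hq : ∑ l ∈ S, a l + 2 * k + q ≤ a.degree) (c : K) :
    monomial a c ∈ irrIdeal K ^ q * I ^ (∑ l ∈ S, a l + k) := by
  classical
  set b := a.filter (· ∈ S) with hb
  have hdeg : b.degree = ∑ l ∈ S, a l := by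
    rw [Finsupp.degree_eq_sum]
    simp [b, Finsupp.filter_apply]
  refine monomial_mem_irrIdeal_mul_of_le
    (b := b + (Finsupp.single i k + Finsupp.single j k)) ?_ ?_ ?_ c
  · intro l
    simp only [hb, Finsupp.add_apply, Finsupp.filter_apply, Finsupp.single_apply]
    by_cases hli : i = l
    · subst hli; simp [hi, hij.symm, hki]
    · by_cases hlj : j = l
      · subst hlj; simp [hj, hij, hkj]
      · simp only [hli, hlj, if_false, add_zero]; split_ifs <;> simp
  · have : (monomial (b + (Finsupp.single i k + Finsupp.single j k)) 1 : MvPolynomial (Fin 4) K)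
        = monomial b 1 * (X i * X j) ^ k := by
      rw [mul_pow, X_pow_eq_monomial, X_pow_eq_monomial, monomial_mul, monomial_mul]
      simp
    rw [this, pow_add]
    refine Ideal.mul_mem_mul ?_ (Ideal.pow_mem_pow hI k)
    have hle : Ideal.span (X '' (S : Set (Fin 4))) ≤ I := by
      rw [Ideal.span_le]
      rintro _ ⟨l, hl, rfl⟩
      exact hS l hl
    refine Ideal.pow_right_mono hle _ (monomial_mem_span_X_pow S b 1 (le_of_eq ?_))
    exact Finset.sum_congr rfl fun l hl => (Finsupp.filter_apply_pos _ _ hl).symm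
  · simp only [map_add, Finsupp.degree_single, hdeg]
    omega

/-- The first `n` coordinate points. -/
def coordPoints (K : Type) [Field K] {n : ℕ} (hn : n ≤ 4) (j : Fin n) : Fin 4 → K :=
  Pi.single (j.castLE hn) 1

lemma le_sum_erase_of_mem_support {n m : ℕ} (hn : n ≤ 4) {f : MvPolynomial (Fin 4) K}
    (hf : f ∈ fatIdeal (coordPoints K hn) m) {a : Fin 4 →₀ ℕ} (ha : a ∈ f.support) (j : Fin n) :
    m ≤ ∑ i ∈ Finset.univ.erase (j.castLE hn), a i := by
  have := mem_fatIdeal.1 hf j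
  rw [coordPoints, pointIdeal_single, mem_span_X_pow_iff] at this
  exact this a ha

lemma X_mem_fatIdeal_coordPoints {n : ℕ} (hn : n ≤ 4) {l : Fin 4} (hl : n ≤ l) :
    (X l : MvPolynomial (Fin 4) K) ∈ fatIdeal (coordPoints K hn) 1 := by
  rw [mem_fatIdeal]
  intro j
  rw [pow_one]
  refine Ideal.subset_span ⟨isHomogeneous_X _ _, ?_⟩
  rw [eval_X, coordPoints, Pi.single_eq_of_ne]
  rintro rfl
  exact absurd hl (by simp)

lemma X_mul_X_mem_fatIdeal_coordPoints {n : ℕ} (hn : n ≤ 4) {i l : Fin 4} (hil : i ≠ l) :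
    (X i * X l : MvPolynomial (Fin 4) K) ∈ fatIdeal (coordPoints K hn) 1 := by
  rw [mem_fatIdeal]
  intro j
  rw [pow_one]
  by_cases hij : i = j.castLE hn
  · refine Ideal.mul_mem_left _ _ (Ideal.subset_span ⟨isHomogeneous_X _ _, ?_⟩)
    rw [eval_X, coordPoints, Pi.single_eq_of_ne (hij ▸ hil.symm)]
  · refine Ideal.mul_mem_right _ _ (Ideal.subset_span ⟨isHomogeneous_X _ _, ?_⟩)
    rw [eval_X, coordPoints, Pi.single_eq_of_ne hij]

lemma fatIdeal_coordPoints_le {n r : ℕ} (hn : n ≤ 4) (hn2 : 2 ≤ n) (hn3 : n ≤ 3) (hr : 1 ≤ r) :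
    fatIdeal (coordPoints K hn) (3 * r - 1) ≤
      irrIdeal K ^ (2 * r - 1) * fatIdeal (coordPoints K hn) 1 ^ r := by
  intro f hf
  rw [as_sum f]
  refine Submodule.sum_mem _ fun a ha => ?_
  have h := fun j => le_sum_erase_of_mem_support _ hf ha j
  have hd := Finsupp.degree_eq_sum a
  have e := fun i => Finset.add_sum_erase Finset.univ a (Finset.mem_univ (i : Fin 4))
  have e0 := e 0
  have e1 := e 1
  have e2 := e 2
  rw [Fin.sum_univ_four] at hd e0 e1 e2
  have hpair : ∀ S : Finset (Fin 4), (∀ l ∈ S, n ≤ (l : ℕ)) → ∀ i j : Fin 4, i ≠ j → i ∉ S →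
      j ∉ S → ∑ l ∈ S, a l < r → r - ∑ l ∈ S, a l ≤ a i → r - ∑ l ∈ S, a l ≤ a j →
      2 * r + (2 * r - 1) ≤ a.degree + ∑ l ∈ S, a l → monomial a (coeff a f) ∈
      irrIdeal K ^ (2 * r - 1) * fatIdeal (coordPoints K hn) 1 ^ r := by
    intro S hS i j hij hi hj hlt hai haj hdeg
    have := monomial_mem_of_pair (q := 2 * r - 1)
      (fun l hl => X_mem_fatIdeal_coordPoints (K := K) hn (hS l hl)) hij hi hj
      (X_mul_X_mem_fatIdeal_coordPoints hn hij) hai haj (by omega) (coeff a f)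
    rwa [Nat.add_sub_cancel' hlt.le] at this
  have hlin : ∀ S : Finset (Fin 4), (∀ l ∈ S, n ≤ (l : ℕ)) → r ≤ ∑ l ∈ S, a l →
      r + (2 * r - 1) ≤ a.degree → monomial a (coeff a f) ∈
      irrIdeal K ^ (2 * r - 1) * fatIdeal (coordPoints K hn) 1 ^ r :=
    fun S hS h1 h2 => monomial_mem_of_linear
      (fun l hl => X_mem_fatIdeal_coordPoints (K := K) hn (hS l hl)) h1 h2 _
  obtain rfl | rfl : n = 2 ∨ n = 3 := by omega
  · have h0 : 3 * r - 1 ≤ ∑ i ∈ Finset.univ.erase (0 : Fin 4), a i := h 0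
    have h1 : 3 * r - 1 ≤ ∑ i ∈ Finset.univ.erase (1 : Fin 4), a i := h 1
    have hS : ∑ l ∈ ({2, 3} : Finset (Fin 4)), a l = a 2 + a 3 := Finset.sum_pair (by decide)
    have hS' : ∀ l ∈ ({2, 3} : Finset (Fin 4)), 2 ≤ (l : ℕ) := by decide
    by_cases hl : r ≤ a 2 + a 3
    · exact hlin {2, 3} hS' (by omega) (by omega)
    · exact hpair {2, 3} hS' 0 1 (by decide) (by decide) (by decide) (by omega) (by omega)
        (by omega) (by omega)
  · have h0 : 3 * r - 1 ≤ ∑ i ∈ Finset.univ.erase (0 : Fin 4), a i := h 0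
    have h1 : 3 * r - 1 ≤ ∑ i ∈ Finset.univ.erase (1 : Fin 4), a i := h 1
    have h2 : 3 * r - 1 ≤ ∑ i ∈ Finset.univ.erase (2 : Fin 4), a i := h 2
    have hS : ∑ l ∈ ({3} : Finset (Fin 4)), a l = a 3 := Finset.sum_singleton _ _
    have hS' : ∀ l ∈ ({3} : Finset (Fin 4)), 3 ≤ (l : ℕ) := by decide
    by_cases hl : r ≤ a 3
    · exact hlin {3} hS' (by omega) (by omega)
    have hp := hpair {3} hS'
    rw [hS] at hp
    by_cases c0 : r - a 3 ≤ a 0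
    · by_cases c1 : r - a 3 ≤ a 1
      · exact hp 0 1 (by decide) (by decide) (by decide) (by omega) c0 c1 (by omega)
      · exact hp 0 2 (by decide) (by decide) (by decide) (by omega) c0 (by omega) (by omega)
    · exact hp 1 2 (by decide) (by decide) (by decide) (by omega) (by omega) (by omega) (by omega)

lemma fatIdeal_le_of_linSubst {n m r q : ℕ} {v w : Fin n → Fin 4 → K}
    {A : Matrix (Fin 4) (Fin 4) K} (hA : IsUnit A.det) (hvw : ∀ j, A.mulVec (w j) = v j)
    (h : fatIdeal w m ≤ irrIdeal K ^ q * fatIdeal w 1 ^ r) :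
    fatIdeal v m ≤ irrIdeal K ^ q * fatIdeal v 1 ^ r := by
  intro f hf
  have hg : linSubst A f ∈ fatIdeal w m :=
    mem_fatIdeal.2 fun j => linSubst_mem_pointIdeal_pow (hvw j) (mem_fatIdeal.1 hf j)
  have hinv : ∀ j, A⁻¹.mulVec (v j) = w j := fun j => by
    rw [← hvw, Matrix.mulVec_mulVec, Matrix.nonsing_inv_mul _ hA, Matrix.one_mulVec]
  have h1 : (fatIdeal w 1).map (linSubst A⁻¹) ≤ fatIdeal v 1 := by
    rw [Ideal.map_le_iff_le_comap]
    intro g hg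
    exact mem_fatIdeal.2 fun j => linSubst_mem_pointIdeal_pow (hinv j) (mem_fatIdeal.1 hg j)
  have h2 : (irrIdeal K).map (linSubst A⁻¹) ≤ irrIdeal K := by
    rw [irrIdeal, Ideal.map_span, Ideal.span_le]
    rintro _ ⟨_, ⟨i, rfl⟩, rfl⟩
    have := mem_irrIdeal_pow (q := 1) (isHomogeneous_linSubst A⁻¹ (isHomogeneous_X K i)) le_rfl
    rwa [pow_one] at this
  have := Ideal.mem_map_of_mem (linSubst A⁻¹) (h hg)
  rw [linSubst_linSubst, Matrix.mul_nonsing_inv _ hA, linSubst_one, Ideal.map_mul, Ideal.map_pow,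
    Ideal.map_pow] at this
  exact Ideal.mul_mono (Ideal.pow_right_mono h2 _) (Ideal.pow_right_mono h1 _) this

end FewPoints

section Vanishing

variable {σ K : Type*} [Field K]

/-- The Taylor shift `f(x) ↦ f(x + p)`. -/
def taylorShift (p : σ → K) : MvPolynomial σ K →ₐ[K] MvPolynomial σ K :=
  aeval fun i => X i + C (p i)

/-- The polynomial `f` vanishes to order at least `m` at the point `p`. -/
def VanishesAt (p : σ → K) (m : ℕ) (f : MvPolynomial σ K) : Prop :=
  taylorShift p f ∈ idealOfVars σ K ^ m

lemma map_idealOfVars_pow_le {τ : Type*} (φ : MvPolynomial σ K →ₐ[K] MvPolynomial τ K)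
    (hφ : ∀ i, φ (X i) ∈ idealOfVars τ K) {m : ℕ} {f : MvPolynomial σ K}
    (hf : f ∈ idealOfVars σ K ^ m) : φ f ∈ idealOfVars τ K ^ m := by
  have h : (idealOfVars σ K).map φ ≤ idealOfVars τ K := by
    rw [idealOfVars, Ideal.map_span, Ideal.span_le]
    rintro _ ⟨_, ⟨i, rfl⟩, rfl⟩
    exact hφ i
  have := Ideal.mem_map_of_mem φ hf
  rw [Ideal.map_pow] at this
  exact Ideal.pow_right_mono h m this

lemma X_mem_idealOfVars (i : σ) : (X i : MvPolynomial σ K) ∈ idealOfVars σ K :=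
  Ideal.subset_span ⟨i, rfl⟩

lemma mem_idealOfVars_pow_of_X_mul_mem {i : σ} {m : ℕ} {h : MvPolynomial σ K}
    (hh : X i * h ∈ idealOfVars σ K ^ m) : h ∈ idealOfVars σ K ^ (m - 1) := by
  rw [mem_pow_idealOfVars_iff] at hh ⊢
  intro a ha
  have := hh (Finsupp.single i 1 + a) (by
    rw [mem_support_iff, coeff_X_mul]; exact mem_support_iff.1 ha)
  rw [map_add, Finsupp.degree_single] at this
  omega

lemma mem_idealOfVars_pow_of_X_add_C_mul_mem {i : σ} {c : K} (hc : c ≠ 0) {m : ℕ}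
    {h : MvPolynomial σ K} (hh : (X i + C c) * h ∈ idealOfVars σ K ^ m) :
    h ∈ idealOfVars σ K ^ m := by
  have key : ∀ k ≤ m, h ∈ idealOfVars σ K ^ k := by
    intro k
    induction k with
    | zero => intro _; simp
    | succ k ih =>
      intro hk
      have h1 : X i * h ∈ idealOfVars σ K ^ (k + 1) := by
        rw [pow_succ']
        exact Ideal.mul_mem_mul (X_mem_idealOfVars i) (ih (by omega))
      have h2 := Ideal.mul_mem_left _ (C c⁻¹) (Ideal.sub_mem _ (Ideal.pow_le_pow_right hk hh) h1)
      have h3 : C c⁻¹ * ((X i + C c) * h - X i * h) = (C c⁻¹ * C c) * h := by ring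
      rwa [h3, ← C_mul, inv_mul_cancel₀ hc, C_1, one_mul] at h2
  exact key m le_rfl

variable {k : ℕ}

/-- Restriction of a polynomial to the hyperplane where the first variable equals `z`. -/
def restrictFirst (z : K) : MvPolynomial (Fin (k + 1)) K →ₐ[K] MvPolynomial (Fin k) K :=
  aeval (Fin.cons (C z) X : Fin (k + 1) → MvPolynomial (Fin k) K)

@[simp] lemma restrictFirst_X_zero (z : K) :
    restrictFirst (k := k) z (X 0) = C z := by
  simp [restrictFirst]

@[simp] lemma restrictFirst_X_succ (z : K) (i : Fin k) : restrictFirst z (X i.succ) = X i := by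
  simp [restrictFirst]

lemma restrictFirst_eq_eval (z : K) (f : MvPolynomial (Fin (k + 1)) K) :
    restrictFirst z f = (finSuccEquiv K k f).eval (C z) := by
  have : restrictFirst (k := k) z = ((Polynomial.aeval (R := MvPolynomial (Fin k) K) (C z :
      MvPolynomial (Fin k) K)).restrictScalars K).comp (finSuccEquiv K k : _ →ₐ[K] _) := by
    refine algHom_ext fun i => ?_
    refine Fin.cases ?_ (fun i => ?_) i
    · simp [finSuccEquiv_X_zero]
    · simp [finSuccEquiv_X_succ]
  rw [this]
  simp [Polynomial.coe_aeval_eq_eval]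

lemma totalDegree_restrictFirst_le (z : K) (f : MvPolynomial (Fin (k + 1)) K) :
    (restrictFirst z f).totalDegree ≤ f.totalDegree := by
  rw [restrictFirst_eq_eval, Polynomial.eval_eq_sum]
  refine totalDegree_finsetSum_le fun i hi => ?_
  beta_reduce
  rw [← C_pow]
  refine (totalDegree_mul _ _).trans ?_
  rw [totalDegree_C, add_zero]
  have := totalDegree_coeff_finSuccEquiv_add_le f i (Polynomial.mem_support_iff.1 hi)
  omega

lemma exists_eq_of_restrictFirst_eq_zero {z : K} {f : MvPolynomial (Fin (k + 1)) K}
    (hf : restrictFirst z f = 0) : ∃ g, f = (X 0 - C z) * g := by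
  rw [restrictFirst_eq_eval] at hf
  obtain ⟨q, hq⟩ := Polynomial.dvd_iff_isRoot.2 hf
  refine ⟨(finSuccEquiv K k).symm q, (finSuccEquiv K k).injective ?_⟩
  rw [hq, map_mul, map_sub, finSuccEquiv_X_zero, AlgEquiv.apply_symm_apply,
    finSuccEquiv_apply]
  simp

lemma VanishesAt.restrictFirst {z : K} {q : Fin k → K} {m : ℕ} {f : MvPolynomial (Fin (k + 1)) K}
    (hf : VanishesAt (Fin.cons z q : Fin (k + 1) → K) m f) :
    VanishesAt q m (restrictFirst z f) := by
  have : (taylorShift q).comp (_root_.restrictFirst z) =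
      (_root_.restrictFirst 0).comp (taylorShift (Fin.cons z q : Fin (k + 1) → K)) := by
    refine algHom_ext fun i => ?_
    refine Fin.cases ?_ (fun i => ?_) i
    · simp [taylorShift]
    · simp [taylorShift]
  have h := DFunLike.congr_fun this f
  rw [AlgHom.comp_apply, AlgHom.comp_apply] at h
  rw [VanishesAt, h]
  refine map_idealOfVars_pow_le _ (fun i => ?_) hf
  refine Fin.cases ?_ (fun i => ?_) i
  · simp
  · simpa using X_mem_idealOfVars i

lemma taylorShift_X_sub_C_mul (z z' : K) (q : Fin k → K) (g : MvPolynomial (Fin (k + 1)) K) :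
    taylorShift (Fin.cons z' q : Fin (k + 1) → K) ((X 0 - C z) * g) =
      (X 0 + C (z' - z)) * taylorShift (Fin.cons z' q : Fin (k + 1) → K) g := by
  simp only [taylorShift, map_mul, map_sub, aeval_X, algHom_C, algebraMap_eq, Fin.cons_zero]
  ring

lemma VanishesAt.of_mul_same {z : K} {q : Fin k → K} {m : ℕ} {g : MvPolynomial (Fin (k + 1)) K}
    (h : VanishesAt (Fin.cons z q : Fin (k + 1) → K) m ((X 0 - C z) * g)) :
    VanishesAt (Fin.cons z q : Fin (k + 1) → K) (m - 1) g := by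
  rw [VanishesAt, taylorShift_X_sub_C_mul, sub_self, C_0, add_zero] at h
  exact mem_idealOfVars_pow_of_X_mul_mem h

lemma VanishesAt.of_mul_ne {z z' : K} (hz : z' ≠ z) {q : Fin k → K} {m : ℕ}
    {g : MvPolynomial (Fin (k + 1)) K}
    (h : VanishesAt (Fin.cons z' q : Fin (k + 1) → K) m ((X 0 - C z) * g)) :
    VanishesAt (Fin.cons z' q : Fin (k + 1) → K) m g := by
  rw [VanishesAt, taylorShift_X_sub_C_mul] at h
  exact mem_idealOfVars_pow_of_X_add_C_mul_mem (sub_ne_zero.2 hz) h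

lemma totalDegree_X_sub_C_mul {z : K} {g : MvPolynomial (Fin (k + 1)) K} (hg : g ≠ 0) :
    ((X 0 - C z) * g).totalDegree = g.totalDegree + 1 := by
  have h1 : (X 0 - C z : MvPolynomial (Fin (k + 1)) K).totalDegree = 1 := by
    refine le_antisymm ((totalDegree_sub _ _).trans (by simp)) ?_
    have hs : Finsupp.single 0 1 ∈ (X 0 - C z : MvPolynomial (Fin (k + 1)) K).support := by
      rw [mem_support_iff]
      simp [coeff_X, coeff_C, eq_comm]
    simpa using le_totalDegree hs
  have h0 : (X 0 - C z : MvPolynomial (Fin (k + 1)) K) ≠ 0 := by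
    intro h; rw [h, totalDegree_zero] at h1; omega
  rw [totalDegree_mul_of_isDomain h0 hg, h1, add_comm]

end Vanishing

section PointBound

/-- There are at most `N` points of `k`-dimensional affine space such that every nonzero
polynomial vanishing to order `m` at these points has degree at least `c * m`. -/
def PointBound (K : Type*) [Field K] (k N : ℕ) (c : ℚ) : Prop :=
  ∃ Z : Finset (Fin k → K), Z.card ≤ N ∧ ∀ f : MvPolynomial (Fin k) K, f ≠ 0 → ∀ m : ℕ,
    (∀ p ∈ Z, VanishesAt p m f) → c * m ≤ f.totalDegree

variable {K : Type*} [Field K] {k : ℕ}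

lemma pointBound_zero (c : ℚ) : PointBound K 0 1 c := by
  refine ⟨{0}, by simp, fun f hf m hm => ?_⟩
  have h := hm 0 (Finset.mem_singleton_self _)
  obtain ⟨a, rfl⟩ := C_surjective (Fin 0) f
  rw [VanishesAt, taylorShift, aeval_C, algebraMap_eq, C_mem_pow_idealOfVars_iff] at h
  obtain rfl : m = 0 := h.resolve_left fun h => hf (by rw [h, C_0])
  simp

lemma sum_mul_le_totalDegree {l : ℕ} {a μ : Fin l → ℚ} {z : Fin l → K}
    (hz : Function.Injective z) (Z : Fin l → Finset (Fin k → K))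
    (hZ : ∀ i, ∀ f : MvPolynomial (Fin k) K, f ≠ 0 → ∀ m : ℕ,
      (∀ p ∈ Z i, VanishesAt p m f) → a i * m ≤ f.totalDegree)
    (ha : ∀ i, 0 < a i) (hμ : ∀ i, 0 ≤ μ i) (hμ1 : ∀ i, μ i ≤ 1) (hs : ∑ i, μ i / a i ≤ 1)
    (d : ℕ) (f : MvPolynomial (Fin (k + 1)) K) (hf : f ≠ 0) (hd : f.totalDegree = d)
    (m : Fin l → ℕ)
    (hm : ∀ i, ∀ p ∈ Z i, VanishesAt (Fin.cons (z i) p : Fin (k + 1) → K) (m i) f) :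
    ∑ i, μ i * m i ≤ d := by
  classical
  induction d generalizing f m with
  | zero => ?_
  | succ d ih => ?_
  all_goals
    by_cases hex : ∃ i, m i ≠ 0 ∧ restrictFirst (z i) f = 0
    swap
    · push Not at hex
      have hi : ∀ i, μ i * m i ≤ μ i / a i * f.totalDegree := by
        intro i
        rw [div_mul_eq_mul_div, mul_div_assoc]
        refine mul_le_mul_of_nonneg_left ?_ (hμ i)
        rw [le_div_iff₀ (ha i), mul_comm]
        by_cases hmi : m i = 0
        · rw [hmi]; simp
        · exact (hZ i _ (hex i hmi) (m i) fun p hp => (hm i p hp).restrictFirst).trans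
            (Nat.cast_le.2 (totalDegree_restrictFirst_le _ _))
      refine (Finset.sum_le_sum fun i _ => hi i).trans ?_
      rw [← Finset.sum_mul, hd]
      exact mul_le_of_le_one_left (Nat.cast_nonneg _) hs
    obtain ⟨i, hi0, hi⟩ := hex
    obtain ⟨g, rfl⟩ := exists_eq_of_restrictFirst_eq_zero hi
    have hg : g ≠ 0 := right_ne_zero_of_mul hf
    rw [totalDegree_X_sub_C_mul hg] at hd
  · omega
  · have := ih g hg (by omega) (Function.update m i (m i - 1)) (by
      intro j p hp
      by_cases hji : j = i
      · subst hji
        rw [Function.update_self]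
        exact (hm j p hp).of_mul_same
      · rw [Function.update_of_ne hji]
        exact (hm j p hp).of_mul_ne fun h => hji (hz h))
    rw [← Finset.add_sum_erase _ _ (Finset.mem_univ i)] at this ⊢
    rw [Function.update_self, Finset.sum_congr rfl fun j hj => by
      rw [Function.update_of_ne (Finset.ne_of_mem_erase hj)], Nat.cast_pred (by omega)] at this
    push_cast
    linarith [hμ1 i]

lemma PointBound.layers [CharZero K] {l : ℕ} {N : Fin l → ℕ} {a : Fin l → ℚ} (μ : Fin l → ℚ)
    (h : ∀ i, PointBound K k (N i) (a i)) (ha : ∀ i, 0 < a i) (hμ : ∀ i, 0 ≤ μ i)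
    (hμ1 : ∀ i, μ i ≤ 1) (hs : ∑ i, μ i / a i ≤ 1) :
    PointBound K (k + 1) (∑ i, N i) (∑ i, μ i) := by
  classical
  choose Z hN hZ using h
  set z : Fin l → K := fun i => (i : ℕ)
  have hz : Function.Injective z := fun i j h => Fin.ext (Nat.cast_injective h)
  refine ⟨Finset.univ.biUnion fun i =>
    (Z i).image fun p => (Fin.cons (z i) p : Fin (k + 1) → K), ?_, fun f hf m hm => ?_⟩
  · exact Finset.card_biUnion_le.trans
      (Finset.sum_le_sum fun i _ => Finset.card_image_le.trans (hN i))
  · rw [Finset.sum_mul]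
    refine sum_mul_le_totalDegree hz Z hZ ha hμ hμ1 hs _ f hf rfl (fun _ => m) fun i p hp => ?_
    exact hm _ (Finset.mem_biUnion.2 ⟨i, Finset.mem_univ _, Finset.mem_image_of_mem _ hp⟩)

lemma PointBound.mono {N N' : ℕ} {c : ℚ} (h : PointBound K k N c) (hN : N ≤ N') :
    PointBound K k N' c := by
  obtain ⟨Z, hZ, h⟩ := h
  exact ⟨Z, hZ.trans hN, h⟩

lemma pointBound_pow [CharZero K] (k : ℕ) {b : ℕ} (hb : 0 < b) : PointBound K k (b ^ k) b := by
  induction k with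
  | zero => exact pointBound_zero _
  | succ k ih =>
    have hb' : (b : ℚ) ≠ 0 := by positivity
    have := PointBound.layers (l := b) (fun _ => 1) (fun _ => ih)
      (fun _ => by positivity) (by simp) (by simp) (by simp [hb'])
    simpa [pow_succ, mul_comm] using this

end PointBound

section ConcreteBounds

variable {K : Type*} [Field K] [CharZero K]

lemma pointBound_line {b : ℕ} (hb : 0 < b) : PointBound K 1 b b := by
  simpa using pointBound_pow (K := K) 1 hb

lemma pointBound_plane_three : PointBound K 2 3 (3 / 2) := by
  have := PointBound.layers (K := K) (k := 1) (N := ![2, 1]) (a := ![2, 1]) ![1, 1 / 2]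
    (by
      rw [Fin.forall_fin_two]
      exact ⟨by simpa using pointBound_line (K := K) two_pos,
        by simpa using pointBound_line (K := K) one_pos⟩)
    (by simp [Fin.forall_fin_succ]) (by simp [Fin.forall_fin_succ])
    (by norm_num [Fin.forall_fin_succ]) (by norm_num [Fin.sum_univ_succ])
  norm_num [Fin.sum_univ_succ] at this
  exact this

lemma pointBound_plane_six : PointBound K 2 6 (13 / 6) := by
  have := PointBound.layers (K := K) (k := 1) (N := ![3, 2, 1]) (a := ![3, 2, 1]) ![1, 1, 1 / 6]
    (by
      rw [Fin.forall_fin_succ, Fin.forall_fin_two]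
      exact ⟨by simpa using pointBound_line (K := K) three_pos,
        by simpa using pointBound_line (K := K) two_pos,
        by simpa using pointBound_line (K := K) one_pos⟩)
    (by simp [Fin.forall_fin_succ]) (by simp [Fin.forall_fin_succ])
    (by norm_num [Fin.forall_fin_succ]) (by norm_num [Fin.sum_univ_succ])
  norm_num [Fin.sum_univ_succ] at this
  exact this

lemma pointBound_space_four : PointBound K 3 4 (4 / 3) := by
  have := PointBound.layers (K := K) (k := 2) (N := ![3, 1]) (a := ![3 / 2, 1]) ![1, 1 / 3]
    (by
      rw [Fin.forall_fin_two]
      exact ⟨pointBound_plane_three, by simpa using pointBound_pow (K := K) 2 one_pos⟩)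
    (by simp [Fin.forall_fin_succ]) (by simp [Fin.forall_fin_succ])
    (by norm_num [Fin.forall_fin_succ]) (by norm_num [Fin.sum_univ_succ])
  norm_num [Fin.sum_univ_succ] at this
  exact this

lemma pointBound_space_eleven : PointBound K 3 11 (53 / 26) := by
  have := PointBound.layers (K := K) (k := 2) (N := ![6, 4, 1]) (a := ![13 / 6, 2, 1])
    ![1, 1, 1 / 26]
    (by
      rw [Fin.forall_fin_succ, Fin.forall_fin_two]
      exact ⟨pointBound_plane_six, by simpa using pointBound_pow (K := K) 2 two_pos,
        by simpa using pointBound_pow (K := K) 2 one_pos⟩)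
    (by simp [Fin.forall_fin_succ]) (by simp [Fin.forall_fin_succ])
    (by norm_num [Fin.forall_fin_succ]) (by norm_num [Fin.sum_univ_succ])
  norm_num [Fin.sum_univ_succ] at this
  exact this

lemma pointBound_space_twentyOne : PointBound K 3 21 (5 / 2) := by
  have := PointBound.layers (K := K) (k := 2) (N := ![9, 9, 3]) (a := ![3, 3, 3 / 2])
    ![1, 1, 1 / 2]
    (by
      rw [Fin.forall_fin_succ, Fin.forall_fin_two]
      exact ⟨by simpa using pointBound_pow (K := K) 2 three_pos,
        by simpa using pointBound_pow (K := K) 2 three_pos, pointBound_plane_three⟩)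
    (by simp [Fin.forall_fin_succ]) (by simp [Fin.forall_fin_succ])
    (by norm_num [Fin.forall_fin_succ]) (by norm_num [Fin.sum_univ_succ])
  norm_num [Fin.sum_univ_succ] at this
  exact this

/-- `l` planar layers of `b ^ 2` points and one further layer of `c ^ 2` points. -/
lemma pointBound_space_layers (b l c : ℕ) (hb : 0 < b) (hc : 0 < c) (hl : l < b)
    (hle : (c : ℚ) * (b - l) ≤ b) :
    PointBound K 3 (l * b ^ 2 + c ^ 2) (l + c * (b - l) / b) := by
  have hb' : (0 : ℚ) < b := by positivity
  have hc' : (0 : ℚ) < c := by positivity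
  have hl' : (l : ℚ) < b := by exact_mod_cast hl
  have := PointBound.layers (K := K) (k := 2) (N := Fin.snoc (fun _ : Fin l => b ^ 2) (c ^ 2))
    (a := Fin.snoc (fun _ : Fin l => (b : ℚ)) c)
    (Fin.snoc (fun _ : Fin l => (1 : ℚ)) (c * (b - l) / b))
    (by
      refine Fin.lastCases ?_ fun i => ?_
      · simpa using pointBound_pow (K := K) 2 hc
      · simpa using pointBound_pow (K := K) 2 hb)
    (by
      refine Fin.lastCases ?_ fun i => ?_
      · simpa using hc
      · simpa using hb)
    (by
      refine Fin.lastCases ?_ fun i => ?_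
      · simp only [Fin.snoc_last]
        have : (0 : ℚ) ≤ b - l := by linarith
        positivity
      · simp)
    (by
      refine Fin.lastCases ?_ fun i => ?_
      · simpa only [Fin.snoc_last] using (div_le_one hb').2 hle
      · simp)
    (by
      rw [Fin.sum_univ_castSucc]
      simp only [Fin.snoc_castSucc, Fin.snoc_last, Finset.sum_const, Finset.card_univ,
        Fintype.card_fin, nsmul_eq_mul]
      apply le_of_eq
      field_simp
      ring)
  simpa [Fin.sum_univ_castSucc] using this

/-- A bound `c` for the initial degrees of `N` points with `c * (3 r - 1) > r (s + 3) - 2`,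
where `N` points are present as soon as forms of degree `s - 1` cannot interpolate. -/
lemma exists_pointBound {n s r : ℕ} (hr : 2 ≤ r) (hs : s ≠ 2) (hn : 1 ≤ n) (hs1 : s = 1 → 4 ≤ n)
    (hsn : s ≠ 0 → (s + 2).choose 3 < n) :
    ∃ c : ℚ, PointBound K 3 n c ∧ (r * (s + 3) : ℚ) - 2 < c * (3 * r - 1) := by
  have hr' : (2 : ℚ) ≤ r := by exact_mod_cast hr
  rcases Nat.lt_or_ge s 9 with h9 | h9
  · have hch : ∀ N, s ≠ 0 → (s + 2).choose 3 + 1 = N → N ≤ n := by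
      intro N h0 h; have := hsn h0; omega
    interval_cases s
    · exact ⟨1, by simpa using (pointBound_pow (K := K) 3 one_pos).mono hn, by push_cast; linarith⟩
    · exact ⟨4 / 3, pointBound_space_four.mono (hs1 rfl), by push_cast; linarith⟩
    · exact absurd rfl hs
    · exact ⟨53 / 26, pointBound_space_eleven.mono (hch 11 (by decide) (by decide)),
        by push_cast; linarith⟩
    · exact ⟨5 / 2, pointBound_space_twentyOne.mono (hch 21 (by decide) (by decide)),
        by push_cast; linarith⟩
    · have hb := pointBound_pow (K := K) 3 three_pos
      exact ⟨3, hb.mono ((by norm_num : 3 ^ 3 ≤ 36).trans (hch 36 (by decide) (by decide))),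
        by push_cast; linarith⟩
    · have hb := pointBound_space_layers (K := K) 4 3 3 (by norm_num) (by norm_num)
        (by norm_num) (by norm_num)
      refine ⟨15 / 4, ?_, by push_cast; linarith⟩
      norm_num at hb
      exact hb.mono (hch 57 (by decide) (by decide))
    · have hb := pointBound_pow (K := K) 3 four_pos
      exact ⟨4, hb.mono ((by norm_num : 4 ^ 3 ≤ 85).trans (hch 85 (by decide) (by decide))),
        by push_cast; linarith⟩
    · have hb := pointBound_space_layers (K := K) 5 4 4 (by norm_num) (by norm_num)
        (by norm_num) (by norm_num)
      refine ⟨24 / 5, ?_, by push_cast; linarith⟩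
      norm_num at hb
      exact hb.mono ((by norm_num : 116 ≤ 121).trans (hch 121 (by decide) (by decide)))
  · obtain ⟨k, hk1, hk2⟩ : ∃ k, 2 * s + 5 ≤ 5 * k ∧ 5 * k ≤ 2 * s + 9 :=
      ⟨(2 * s + 9) / 5, by omega, by omega⟩
    refine ⟨k, (pointBound_pow 3 (by omega)).mono ?_, ?_⟩
    · have h1 := hsn (by omega)
      have h2 : (s + 2) * ((s + 1) * s) = 6 * (s + 2).choose 3 := by
        have := Nat.descFactorial_eq_factorial_mul_choose (s + 2) 3
        simpa [Nat.descFactorial, Nat.factorial, mul_comm, mul_assoc, mul_left_comm] using this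
      have h3 : (5 * k) ^ 3 ≤ (2 * s + 9) ^ 3 := Nat.pow_le_pow_left hk2 3
      obtain ⟨t, rfl⟩ := Nat.exists_eq_add_of_le h9
      rw [mul_pow] at h3
      have h4 : 6 * (2 * (9 + t) + 9) ^ 3 ≤ 125 * ((9 + t + 2) * ((9 + t + 1) * (9 + t))) := by
        nlinarith [sq_nonneg t, pow_nonneg (Nat.zero_le t) 3]
      rw [h2] at h4
      omega
    · have hk : (2 * s + 5 : ℚ) ≤ 5 * k := by exact_mod_cast hk1
      have hs9 : (9 : ℚ) ≤ s := by exact_mod_cast h9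
      nlinarith

end ConcreteBounds

section HomogeneousVanishing

variable {σ K : Type*} [Field K]

lemma aeval_mul_of_isHomogeneous {A : Type*} [CommRing A] [Algebra K A] {f : MvPolynomial σ K}
    {D : ℕ} (hf : f.IsHomogeneous D) (c : A) (γ : σ → A) :
    aeval (fun i => c * γ i) f = c ^ D * aeval γ f := by
  rw [f.as_sum, map_sum, map_sum, Finset.mul_sum]
  refine Finset.sum_congr rfl fun a ha => ?_
  have hD : a.degree = D := degree_of_mem_support hf ha
  simp only [aeval_monomial, Finsupp.prod, mul_pow, Finset.prod_mul_distrib]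
  rw [Finset.prod_pow_eq_pow_sum, ← Finsupp.degree_apply, hD]
  ring

lemma exists_fin_cover {α : Type*} [Nonempty α] (Z : Finset α) {n : ℕ} (h : Z.card ≤ n) :
    ∃ q : Fin n → α, ∀ p ∈ Z, ∃ j, q j = p := by
  refine ⟨fun j => if h : j.1 < Z.card then (Z.equivFin.symm ⟨j, h⟩ : α) else Classical.arbitrary α,
    fun p hp => ⟨⟨Z.equivFin ⟨p, hp⟩, (Fin.is_lt _).trans_le h⟩, ?_⟩⟩
  simp

lemma restrictFirst_one_ne_zero [Infinite K] {k D : ℕ} {f : MvPolynomial (Fin (k + 1)) K}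
    (hf : f.IsHomogeneous D) (h0 : f ≠ 0) : restrictFirst 1 f ≠ 0 := by
  intro h
  refine mul_ne_zero (X_ne_zero 0) h0 (MvPolynomial.funext fun x => ?_)
  rw [map_mul, eval_X, map_zero]
  by_cases hx : x 0 = 0
  · rw [hx, zero_mul]
  have h1 : aeval (fun i : Fin k => (x 0)⁻¹ * x i.succ) (restrictFirst 1 f) =
      (x 0)⁻¹ ^ D * eval x f := by
    rw [← coe_aeval_eq_eval, RingHom.coe_coe, ← aeval_mul_of_isHomogeneous hf, restrictFirst,
      ← AlgHom.comp_apply]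
    congr 1
    refine algHom_ext fun i => ?_
    refine Fin.cases ?_ (fun i => ?_) i
    · simp [hx]
    · simp
  rw [h, map_zero, eq_comm, mul_eq_zero] at h1
  rw [h1.resolve_left (pow_ne_zero _ (inv_ne_zero hx)), mul_zero]

lemma pow_dvd_aeval {f : MvPolynomial σ K} {D m : ℕ} (hf : f.IsHomogeneous D) {w : σ → K}
    (hw : VanishesAt w m f) (γ : σ → Polynomial K) {t c : K} (hc : c ≠ 0)
    (hγ : ∀ i, (γ i).eval t = c * w i) : (Polynomial.X - Polynomial.C t) ^ m ∣ aeval γ f := by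
  set δ : σ → Polynomial K := fun i => Polynomial.C c⁻¹ * γ i - Polynomial.C (w i)
  have h1 : aeval δ (taylorShift w f) = Polynomial.C c⁻¹ ^ D * aeval γ f := by
    rw [← aeval_mul_of_isHomogeneous hf, taylorShift, ← AlgHom.comp_apply]
    congr 1
    refine algHom_ext fun i => ?_
    simp [δ, Polynomial.algebraMap_eq]
  have h2 : aeval δ (taylorShift w f) ∈
      Ideal.span {(Polynomial.X - Polynomial.C t : Polynomial K)} ^ m := by
    have h := Ideal.mem_map_of_mem (aeval δ) hw
    rw [Ideal.map_pow] at h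
    refine Ideal.pow_right_mono ?_ m h
    rw [idealOfVars, Ideal.map_span, Ideal.span_le]
    rintro _ ⟨_, ⟨i, rfl⟩, rfl⟩
    rw [SetLike.mem_coe, Ideal.mem_span_singleton, aeval_X, Polynomial.dvd_iff_isRoot]
    simp [δ, hγ, hc]
  rw [Ideal.span_singleton_pow, Ideal.mem_span_singleton, h1] at h2
  refine (IsUnit.dvd_mul_left ?_).1 h2
  exact ((Polynomial.isUnit_C.2 (inv_ne_zero hc).isUnit)).pow D

end HomogeneousVanishing

section FivePoints

variable {K : Type*} [Field K]

/-- The coordinate points of projective 3-space together with the point `(1 : 1 : 1 : 1)`. -/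
def frame (K : Type*) [Field K] : Option (Fin 4) → Fin 4 → K
  | none => fun _ => 1
  | some j => Pi.single j 1

lemma eval_eq_zero_of_vanishesAt_frame {f : MvPolynomial (Fin 4) K} {D m : ℕ}
    (hf : f.IsHomogeneous D) (hv : ∀ o, VanishesAt (frame K o) m f) (hDm : 3 * D < 5 * m)
    {p : Fin 4 → K} (h0 : ∀ i, p i ≠ 0) (h1 : ∀ i, p i ≠ 1) (hp : Function.Injective p) :
    eval p f = 0 := by
  classical
  set z : Fin 4 → Polynomial K := fun j => Polynomial.C (p j - 1) * Polynomial.X + 1 with hz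
  set γ : Fin 4 → Polynomial K := fun i =>
    Polynomial.C (p i) * ∏ j ∈ Finset.univ.erase i, z j with hγ
  set t : Option (Fin 4) → K := fun o => o.elim 1 fun j => (1 - p j)⁻¹ with ht
  have h1' : ∀ i, 1 - p i ≠ 0 := fun i => sub_ne_zero.2 (h1 i).symm
  have htinj : Function.Injective t := by
    rintro (_ | i) (_ | j) h
    · rfl
    · simp only [ht, Option.elim] at h
      rw [eq_comm, inv_eq_one] at h
      exact absurd (by linear_combination -h) (h0 j)
    · simp only [ht, Option.elim] at h
      rw [inv_eq_one] at h
      exact absurd (by linear_combination -h) (h0 i)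
    · simp only [ht, Option.elim] at h
      have := inv_injective h
      exact congrArg some (hp (by linear_combination -this))
  have hzt : ∀ j k, (z j).eval (1 - p k)⁻¹ = (p j - p k) * (1 - p k)⁻¹ := by
    intro j k
    simp only [hz, Polynomial.eval_add, Polynomial.eval_mul, Polynomial.eval_C, Polynomial.eval_X,
      Polynomial.eval_one]
    have := h1' k
    field_simp
    ring
  have hdvd : ∀ o, (Polynomial.X - Polynomial.C (t o)) ^ m ∣ aeval γ f := by
    rintro (_ | k)
    · refine pow_dvd_aeval hf (hv none) γ (c := ∏ i, p i) (Finset.prod_ne_zero_iff.2 fun i _ => h0 i)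
        fun i => ?_
      simp only [hγ, hz, ht, frame, Option.elim, Polynomial.eval_mul, Polynomial.eval_C,
        Polynomial.eval_prod, Polynomial.eval_add, Polynomial.eval_X, Polynomial.eval_one, mul_one,
        sub_add_cancel]
      exact Finset.mul_prod_erase _ _ (Finset.mem_univ i)
    · refine pow_dvd_aeval hf (hv (some k)) γ (c := (γ k).eval (1 - p k)⁻¹) ?_ fun i => ?_
      · simp only [hγ, Polynomial.eval_mul, Polynomial.eval_C, Polynomial.eval_prod]
        refine mul_ne_zero (h0 k) (Finset.prod_ne_zero_iff.2 fun j hj => ?_)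
        rw [hzt]
        exact mul_ne_zero (sub_ne_zero.2 fun h => Finset.ne_of_mem_erase hj (hp h))
          (inv_ne_zero (h1' k))
      · simp only [ht, frame, Option.elim]
        rcases eq_or_ne i k with rfl | hik
        · simp
        · rw [Pi.single_eq_of_ne hik, mul_zero]
          simp only [hγ, Polynomial.eval_mul, Polynomial.eval_prod]
          rw [Finset.prod_eq_zero (Finset.mem_erase.2 ⟨hik.symm, Finset.mem_univ k⟩)
            (by rw [hzt, sub_self, zero_mul]), mul_zero]
  have hprod : ∏ o, (Polynomial.X - Polynomial.C (t o)) ^ m ∣ aeval γ f :=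
    Finset.prod_dvd_of_coprime
      (fun i _ j _ hij => (Polynomial.pairwise_coprime_X_sub_C htinj hij).pow) fun o _ => hdvd o
  have hzero : aeval γ f = 0 := by
    refine Polynomial.eq_zero_of_dvd_of_natDegree_lt hprod ?_
    have hle : (aeval γ f).natDegree ≤ D * 3 := by
      refine aeval_natDegree_le f hf.totalDegree_le γ fun i => ?_
      refine (Polynomial.natDegree_C_mul_le _ _).trans ((Polynomial.natDegree_prod_le _ _).trans ?_)
      refine (Finset.sum_le_card_nsmul _ _ 1 fun j _ => ?_).trans (by simp)
      exact Polynomial.natDegree_linear_le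
    rw [Polynomial.natDegree_prod _ _ fun o _ => pow_ne_zero _ (Polynomial.X_sub_C_ne_zero _)]
    simp only [Polynomial.natDegree_pow, Polynomial.natDegree_X_sub_C, mul_one, Finset.sum_const,
      Finset.card_univ, Fintype.card_option, Fintype.card_fin, smul_eq_mul]
    omega
  have hev : (aeval γ f).eval 0 = eval p f := by
    have : ((Polynomial.aeval (R := K) (0 : K)).comp (aeval γ)) = aeval p := by
      refine algHom_ext fun i => ?_
      simp [hγ, hz, Polynomial.coe_aeval_eq_eval, Polynomial.eval_prod]
    have h := DFunLike.congr_fun this f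
    rw [AlgHom.comp_apply, Polynomial.coe_aeval_eq_eval] at h
    rw [h, ← coe_aeval_eq_eval, RingHom.coe_coe]
  rw [← hev, hzero, Polynomial.eval_zero]

lemma eq_zero_of_vanishesAt_frame [Infinite K] {f : MvPolynomial (Fin 4) K} {D m : ℕ}
    (hf : f.IsHomogeneous D) (hv : ∀ o, VanishesAt (frame K o) m f) (hDm : 3 * D < 5 * m) :
    f = 0 := by
  classical
  set g : MvPolynomial (Fin 4) K := (∏ i, X i) * (∏ i, (X i - 1)) *
    ∏ x ∈ Finset.univ.offDiag, (X (x : Fin 4 × Fin 4).1 - X x.2) with hg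
  have hXX : ∀ i j : Fin 4, i ≠ j → (X i - X j : MvPolynomial (Fin 4) K) ≠ 0 := fun i j hij h =>
    hij (X_injective (sub_eq_zero.1 h))
  have hX1 : ∀ i : Fin 4, (X i - 1 : MvPolynomial (Fin 4) K) ≠ 0 := fun i h => by
    have := congrArg (eval fun _ => (0 : K)) h
    simp at this
  have hg0 : g ≠ 0 := by
    refine mul_ne_zero (mul_ne_zero ?_ ?_) ?_ <;> refine Finset.prod_ne_zero_iff.2 fun i hi => ?_
    · exact X_ne_zero i
    · exact hX1 i
    · exact hXX _ _ (Finset.mem_offDiag.1 hi).2.2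
  refine (mul_eq_zero.1 (?_ : g * f = 0)).resolve_left hg0
  refine MvPolynomial.funext fun p => ?_
  rw [map_mul, map_zero]
  by_cases hp : eval p g = 0
  · rw [hp, zero_mul]
  rw [hg, map_mul, map_mul, map_prod, map_prod, map_prod] at hp
  simp only [map_sub, eval_X, map_one, mul_ne_zero_iff, Finset.prod_ne_zero_iff, sub_ne_zero,
    ← ne_eq] at hp
  rw [eval_eq_zero_of_vanishesAt_frame hf hv hDm (fun i => hp.1.1 i (Finset.mem_univ i))
    (fun i => hp.1.2 i (Finset.mem_univ i)) ?_, mul_zero]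
  intro i j h
  by_contra hij
  exact hp.2 (i, j) (Finset.mem_offDiag.2 ⟨Finset.mem_univ _, Finset.mem_univ _, hij⟩) h

end FivePoints

section SpecialPoints

variable {K : Type*} [Field K] [CharZero K]

/-- There are `n` points such that no nonzero form of degree `r (s + 3) - 2` vanishes to order
`3 r - 1` at all of them. -/
lemma exists_points_forall_eq_zero {n s r : ℕ} (hr : 2 ≤ r) (hn : 1 ≤ n)
    (hs1 : s = 1 → 4 ≤ n) (hsn : s ≠ 0 → (s + 2).choose 3 < n) :
    ∃ v : Fin n → Fin 4 → K, ∀ f : MvPolynomial (Fin 4) K, f.IsHomogeneous (r * (s + 3) - 2) →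
      (∀ j, VanishesAt (v j) (3 * r - 1) f) → f = 0 := by
  classical
  by_cases hs : s = 2
  · subst hs
    have hn5 : 5 ≤ n := hsn (by norm_num)
    obtain ⟨v, hv⟩ := exists_fin_cover (Finset.univ.image (frame K))
      (Finset.card_image_le.trans (by simpa using hn5))
    refine ⟨v, fun f hf hvf => eq_zero_of_vanishesAt_frame hf (m := 3 * r - 1) (fun o => ?_)
      (by omega)⟩
    obtain ⟨j, hj⟩ := hv _ (Finset.mem_image_of_mem _ (Finset.mem_univ o))
    exact hj ▸ hvf j
  · obtain ⟨c, ⟨Z, hZ, hb⟩, hc⟩ := exists_pointBound (K := K) hr hs hn hs1 hsn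
    obtain ⟨q, hq⟩ := exists_fin_cover Z hZ
    refine ⟨fun j => Fin.cons 1 (q j), fun f hf hvf => ?_⟩
    by_contra h0
    have h1 := hb _ (restrictFirst_one_ne_zero hf h0) (3 * r - 1) fun p hp => by
      obtain ⟨j, rfl⟩ := hq p hp
      exact (hvf j).restrictFirst
    have h2 : (restrictFirst 1 f).totalDegree ≤ r * (s + 3) - 2 :=
      (totalDegree_restrictFirst_le _ _).trans hf.totalDegree_le
    have h3 : ((restrictFirst 1 f).totalDegree : ℚ) ≤ r * (s + 3) - 2 := by
      have h4 : 2 ≤ r * (s + 3) := by nlinarith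
      have := (Nat.cast_le (α := ℚ)).2 h2
      rw [Nat.cast_sub h4] at this
      push_cast at this
      exact this
    rw [Nat.cast_sub (by omega)] at h1
    push_cast at h1
    linarith

end SpecialPoints

section Genericity

variable {K : Type*} [Field K] {n : ℕ}

/-- The property `P` holds for `n` vectors outside the zero set of a nonzero polynomial. -/
def HoldsGenerically (P : (Fin n → Fin 4 → K) → Prop) : Prop :=
  ∃ G : MvPolynomial (Fin n × Fin 4) K, G ≠ 0 ∧ ∀ v, eval (fun p => v p.1 p.2) G ≠ 0 → P v

lemma HoldsGenerically.and {P Q : (Fin n → Fin 4 → K) → Prop} (hP : HoldsGenerically P)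
    (hQ : HoldsGenerically Q) : HoldsGenerically fun v => P v ∧ Q v := by
  obtain ⟨G, hG, hP⟩ := hP
  obtain ⟨H, hH, hQ⟩ := hQ
  refine ⟨G * H, mul_ne_zero hG hH, fun v hv => ?_⟩
  rw [map_mul] at hv
  exact ⟨hP v (left_ne_zero_of_mul hv), hQ v (right_ne_zero_of_mul hv)⟩

lemma HoldsGenerically.mono {P Q : (Fin n → Fin 4 → K) → Prop} (hP : HoldsGenerically P)
    (h : ∀ v, P v → Q v) : HoldsGenerically Q := by
  obtain ⟨G, hG, hP⟩ := hP
  exact ⟨G, hG, fun v hv => h v (hP v hv)⟩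

lemma holdsGenerically_of_eval_ne_zero {P : (Fin n → Fin 4 → K) → Prop}
    (G : MvPolynomial (Fin n × Fin 4) K) (v₀ : Fin n → Fin 4 → K)
    (h₀ : eval (fun p => v₀ p.1 p.2) G ≠ 0) (h : ∀ v, eval (fun p => v p.1 p.2) G ≠ 0 → P v) :
    HoldsGenerically P :=
  ⟨G, fun hG => h₀ (by rw [hG, map_zero]), h⟩

lemma holdsGenerically_ne_zero : HoldsGenerically fun v : Fin n → Fin 4 → K => ∀ j, v j 0 ≠ 0 := by
  refine ⟨∏ j, X (j, 0), Finset.prod_ne_zero_iff.2 fun j _ => X_ne_zero _, fun v hv j => ?_⟩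
  simp only [map_prod, eval_X, Finset.prod_ne_zero_iff] at hv
  exact hv j (Finset.mem_univ j)

lemma holdsGenerically_mulVec_injective {κ ι : Type*} [Fintype κ] [Fintype ι]
    (M : Matrix κ ι (MvPolynomial (Fin n × Fin 4) K)) (v₀ : Fin n → Fin 4 → K)
    (h : Function.Injective (M.map (eval fun p => v₀ p.1 p.2)).mulVec) :
    HoldsGenerically fun v : Fin n → Fin 4 → K =>
      Function.Injective (M.map (eval fun p => v p.1 p.2)).mulVec := by
  classical
  obtain ⟨g, hg⟩ := LinearMap.exists_leftInverse_of_injective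
    (Matrix.toLin' (M.map (eval fun p => v₀ p.1 p.2)))
    (LinearMap.ker_eq_bot.2 (by rwa [Matrix.toLin'_apply', Matrix.coe_mulVecLin]))
  set B := LinearMap.toMatrix' g
  have hB : B * M.map (eval fun p => v₀ p.1 p.2) = 1 := by
    rw [← LinearMap.toMatrix'_toLin' (M.map (eval fun p => v₀ p.1 p.2)), ← LinearMap.toMatrix'_comp,
      hg, LinearMap.toMatrix'_id]
  set B' : Matrix ι κ (MvPolynomial (Fin n × Fin 4) K) := B.map C with hB'
  set N : Matrix ι ι (MvPolynomial (Fin n × Fin 4) K) := B' * M with hN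
  have hdet : ∀ v : Fin n → Fin 4 → K, eval (fun p => v p.1 p.2) N.det =
      (B * M.map (eval fun p => v p.1 p.2)).det := by
    intro v
    rw [RingHom.map_det, RingHom.mapMatrix_apply, hN, Matrix.map_mul, hB', Matrix.map_map]
    congr 2
    ext i j
    simp
  refine holdsGenerically_of_eval_ne_zero N.det v₀ ?_ fun v hv => ?_
  · rw [hdet, hB, Matrix.det_one]
    exact one_ne_zero
  · rw [hdet] at hv
    have := Matrix.mulVec_injective_of_isUnit
      ((Matrix.isUnit_iff_isUnit_det _).2 (isUnit_iff_ne_zero.2 hv))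
    intro x y hxy
    apply this
    simp only [← Matrix.mulVec_mulVec]
    exact congrArg _ hxy

/-- The exponents of the monomials of degree `D` in four variables. -/
abbrev exponents (D : ℕ) : Finset (Fin 4 →₀ ℕ) := Finset.finsuppAntidiag Finset.univ D

lemma mem_exponents {D : ℕ} {a : Fin 4 →₀ ℕ} : a ∈ exponents D ↔ a.degree = D := by
  simp [exponents, Finsupp.degree_eq_sum]

lemma card_exponents (D : ℕ) : (exponents D).card = (D + 3).choose 3 := by
  rw [exponents, Finset.card_finsuppAntidiag_nat_eq_choose, Finset.card_univ, Fintype.card_fin,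
    show 4 + D - 1 = D + 3 by omega, ← Nat.choose_symm_add, add_comm]

/-- The form of degree `D` with prescribed coefficients. -/
def formOf {D : ℕ} (x : exponents D → K) : MvPolynomial (Fin 4) K :=
  ∑ a, monomial a.1 (x a)

lemma isHomogeneous_formOf {D : ℕ} (x : exponents D → K) : (formOf x).IsHomogeneous D :=
  IsHomogeneous.sum _ _ _ fun a _ => isHomogeneous_monomial _ (mem_exponents.1 a.2)

lemma formOf_coeff {D : ℕ} {f : MvPolynomial (Fin 4) K} (hf : f.IsHomogeneous D) :
    formOf (fun a : exponents D => coeff a.1 f) = f := by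
  conv_rhs => rw [f.as_sum]
  rw [formOf, Finset.sum_coe_sort (exponents D) fun a => monomial a (coeff a f)]
  refine (Finset.sum_subset (fun a ha => mem_exponents.2 (degree_of_mem_support hf ha))
    fun a _ ha => ?_).symm
  rw [notMem_support_iff.1 ha, monomial_zero]

lemma formOf_injective {D : ℕ} : Function.Injective (formOf (K := K) (D := D)) := by
  classical
  intro x y h
  funext a
  have := congrArg (coeff a.1) h
  simpa [formOf, coeff_sum, coeff_monomial, Subtype.coe_inj] using this

lemma formOf_zero {D : ℕ} : formOf (0 : exponents D → K) = 0 := by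
  simp [formOf]

/-- The Taylor shift at the `j`-th of `n` points with indeterminate coordinates. -/
def genericShift (K : Type*) [Field K] {n : ℕ} (j : Fin n) :
    MvPolynomial (Fin 4) K →ₐ[K] MvPolynomial (Fin 4) (MvPolynomial (Fin n × Fin 4) K) :=
  aeval fun i => X i + C (X (j, i))

lemma map_eval_genericShift (v : Fin n → Fin 4 → K) (j : Fin n) (f : MvPolynomial (Fin 4) K) :
    map (eval fun p => v p.1 p.2) (genericShift K j f) = taylorShift (v j) f := by
  induction f using MvPolynomial.induction_on with
  | C a =>
    simp [genericShift, taylorShift, IsScalarTower.algebraMap_apply K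
      (MvPolynomial (Fin n × Fin 4) K) (MvPolynomial (Fin 4) (MvPolynomial (Fin n × Fin 4) K)),
      algebraMap_eq]
  | add p q hp hq => simp only [map_add, hp, hq]
  | mul_X p i hp =>
    rw [map_mul, map_mul, map_mul, hp]
    simp [genericShift, taylorShift]

lemma holdsGenerically_forall_eq_zero {D m : ℕ} (v₀ : Fin n → Fin 4 → K)
    (h₀ : ∀ f : MvPolynomial (Fin 4) K, f.IsHomogeneous D →
      (∀ j, VanishesAt (v₀ j) m f) → f = 0) :
    HoldsGenerically fun v : Fin n → Fin 4 → K => ∀ f : MvPolynomial (Fin 4) K,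
      f.IsHomogeneous D → (∀ j, VanishesAt (v j) m f) → f = 0 := by
  classical
  set M : Matrix (Fin n × (Finset.range m).biUnion exponents) (exponents D)
      (MvPolynomial (Fin n × Fin 4) K) :=
    fun y a => coeff y.2.1 (genericShift K y.1 (monomial a.1 1)) with hM
  have hmul : ∀ (v : Fin n → Fin 4 → K) x y, (M.map (eval fun p => v p.1 p.2)).mulVec x y =
      coeff y.2.1 (taylorShift (v y.1) (formOf x)) := by
    intro v x y
    rw [formOf, map_sum, coeff_sum, Matrix.mulVec, dotProduct]
    refine Finset.sum_congr rfl fun a _ => ?_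
    rw [Matrix.map_apply, hM, ← coeff_map, map_eval_genericShift, mul_comm, ← smul_eq_mul,
      ← coeff_smul, ← map_smul, smul_monomial, smul_eq_mul, mul_one]
  have hvan : ∀ (v : Fin n → Fin 4 → K) x, (M.map (eval fun p => v p.1 p.2)).mulVec x = 0 ↔
      ∀ j, VanishesAt (v j) m (formOf x) := by
    intro v x
    simp only [funext_iff, hmul, VanishesAt, mem_pow_idealOfVars_iff', Pi.zero_apply]
    constructor
    · intro h j b hb
      exact h (j, ⟨b, Finset.mem_biUnion.2 ⟨_, Finset.mem_range.2 hb, mem_exponents.2 rfl⟩⟩)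
    · rintro h ⟨j, b, hb⟩
      obtain ⟨k, hk, hb⟩ := Finset.mem_biUnion.1 hb
      exact h j b (by rw [mem_exponents.1 hb]; exact Finset.mem_range.1 hk)
  have hinj : ∀ v : Fin n → Fin 4 → K,
      Function.Injective (M.map (eval fun p => v p.1 p.2)).mulVec ↔
      ∀ f : MvPolynomial (Fin 4) K, f.IsHomogeneous D → (∀ j, VanishesAt (v j) m f) → f = 0 := by
    intro v
    have := injective_iff_map_eq_zero (M.map (eval fun p => v p.1 p.2)).mulVecLin
    simp only [Matrix.coe_mulVecLin, Matrix.mulVecLin_apply, hvan] at this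
    rw [this]
    constructor
    · intro h f hf hfv
      rw [← formOf_coeff hf] at hfv ⊢
      rw [h _ hfv, formOf_zero]
    · intro h x hx
      exact formOf_injective ((h _ (isHomogeneous_formOf x) hx).trans formOf_zero.symm)
  exact (holdsGenerically_mulVec_injective M v₀ ((hinj v₀).2 h₀)).mono fun v => (hinj v).1

lemma exists_injOn_prod_pow [Infinite K] (S : Finset (Fin 4 →₀ ℕ)) :
    ∃ w : Fin 4 → K, Set.InjOn (fun a : Fin 4 →₀ ℕ => ∏ k, w k ^ a k) S := by
  classical
  set g : MvPolynomial (Fin 4) K := ∏ x ∈ S.offDiag, (monomial x.1 1 - monomial x.2 1)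
  have hg : g ≠ 0 := Finset.prod_ne_zero_iff.2 fun x hx h =>
    (Finset.mem_offDiag.1 hx).2.2 (monomial_left_injective one_ne_zero (sub_eq_zero.1 h))
  obtain ⟨w, hw⟩ : ∃ w, eval w g ≠ 0 := by
    by_contra! h
    exact hg (MvPolynomial.funext fun w => by rw [h w, map_zero])
  refine ⟨w, fun a ha b hb hab => ?_⟩
  by_contra hne
  rw [map_prod, Finset.prod_ne_zero_iff] at hw
  refine hw (a, b) (Finset.mem_offDiag.2 ⟨ha, hb, hne⟩) ?_
  simpa [eval_monomial, Finsupp.prod_fintype, sub_eq_zero] using hab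

end Genericity

section Generic

variable {K : Type} [Field K] {n : ℕ}

lemma holdsGenerically_exists_isDualFamily [Infinite K] {s : ℕ} (hn : n ≤ (s + 3).choose 3) :
    HoldsGenerically fun v : Fin n → Fin 4 → K => ∃ u, IsDualFamily v s u := by
  classical
  obtain ⟨φ⟩ : Nonempty (Fin n ↪ exponents s) :=
    Function.Embedding.nonempty_of_card_le (by simpa [card_exponents] using hn)
  obtain ⟨w, hw⟩ := exists_injOn_prod_pow (K := K) (exponents s)
  set N : Matrix (Fin n) (Fin n) (MvPolynomial (Fin n × Fin 4) K) :=
    Matrix.of fun j i => ∏ k, X (j, k) ^ (φ i).1 k with hN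
  have hdet : ∀ v : Fin n → Fin 4 → K, eval (fun p => v p.1 p.2) N.det =
      (Matrix.of fun j i => ∏ k, v j k ^ (φ i).1 k).det := by
    intro v
    rw [RingHom.map_det]
    congr 1
    ext j i
    simp [hN]
  refine holdsGenerically_of_eval_ne_zero N.det (fun j k => w k ^ (j : ℕ)) ?_ fun v hv => ?_
  · rw [hdet fun j k => w k ^ (j : ℕ), ← Matrix.det_transpose]
    have : (Matrix.of fun j i : Fin n => ∏ k, (w k ^ (j : ℕ)) ^ (φ i).1 k).transpose =
        Matrix.vandermonde fun i => ∏ k, w k ^ (φ i).1 k := by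
      ext i j
      simp only [Matrix.transpose_apply, Matrix.of_apply, Matrix.vandermonde_apply,
        ← Finset.prod_pow, ← pow_mul, mul_comm]
    rw [this, Matrix.det_vandermonde_ne_zero_iff]
    exact fun i j h => φ.injective (Subtype.ext (hw (φ i).2 (φ j).2 h))
  · rw [hdet] at hv
    set E : Matrix (Fin n) (Fin n) K := Matrix.of fun j i => ∏ k, v j k ^ (φ i).1 k with hE
    refine ⟨fun j => ∑ i, monomial (φ i).1 (E⁻¹ i j), fun j => ?_, fun i j => ?_⟩
    · exact IsHomogeneous.sum _ _ _ fun i _ => isHomogeneous_monomial _ (mem_exponents.1 (φ i).2)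
    · have h := congrFun (congrFun (Matrix.mul_nonsing_inv E (isUnit_iff_ne_zero.2 hv)) i) j
      rw [Matrix.mul_apply, Matrix.one_apply] at h
      rw [← h, map_sum]
      refine Finset.sum_congr rfl fun k _ => ?_
      rw [eval_monomial, Finsupp.prod_fintype _ _ fun _ => pow_zero _, mul_comm, hE,
        Matrix.of_apply]

lemma holdsGenerically_exists_mulVec_coordPoints (hn : n ≤ 4) :
    HoldsGenerically fun v : Fin n → Fin 4 → K => ∃ A : Matrix (Fin 4) (Fin 4) K,
      IsUnit A.det ∧ ∀ j, A.mulVec (coordPoints K hn j) = v j := by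
  classical
  set N : Matrix (Fin 4) (Fin 4) (MvPolynomial (Fin n × Fin 4) K) :=
    Matrix.of fun i l => if h : (l : ℕ) < n then X (⟨l, h⟩, i) else if i = l then 1 else 0 with hN
  refine holdsGenerically_of_eval_ne_zero N.det (coordPoints K hn) ?_ fun v hv =>
    ⟨N.map (eval fun p => v p.1 p.2), ?_, fun j => ?_⟩
  · rw [RingHom.map_det]
    have : (eval fun p : Fin n × Fin 4 => coordPoints K hn p.1 p.2).mapMatrix N = 1 := by
      ext i l
      simp only [RingHom.mapMatrix_apply, Matrix.map_apply, hN, Matrix.one_apply]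
      by_cases h : (l : ℕ) < n
      · simp [h, coordPoints, Fin.castLE, Pi.single_apply]
      · by_cases hil : i = l <;> simp [h, hil]
    rw [this, Matrix.det_one]
    exact one_ne_zero
  · rw [RingHom.map_det] at hv
    exact isUnit_iff_ne_zero.2 hv
  · rw [coordPoints, Matrix.mulVec_single_one]
    ext i
    simp [hN, Matrix.col_apply]

lemma vanishesAt_of_mem_pointIdeal_pow {w : Fin 4 → K} {m : ℕ} {f : MvPolynomial (Fin 4) K}
    (hf : f ∈ pointIdeal K w ^ m) : VanishesAt w m f := by
  have h := Ideal.mem_map_of_mem (taylorShift w) hf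
  rw [Ideal.map_pow] at h
  refine Ideal.pow_right_mono ?_ m h
  rw [pointIdeal, Ideal.map_span, Ideal.span_le]
  rintro _ ⟨g, ⟨hg, hgw⟩, rfl⟩
  have : eval 0 (taylorShift w g) = eval w g := by
    rw [← coe_aeval_eq_eval, ← coe_aeval_eq_eval, RingHom.coe_coe, RingHom.coe_coe, taylorShift,
      ← AlgHom.comp_apply]
    congr 1
    refine algHom_ext fun i => ?_
    simp
  rw [SetLike.mem_coe, ← pow_one (idealOfVars (Fin 4) K), mem_pow_idealOfVars_iff']
  intro b hb
  obtain rfl : b = 0 := (Finsupp.degree_eq_zero_iff _).1 (by omega)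
  rw [← constantCoeff_eq, ← eval_zero, this, hgw]

lemma fatIdeal_le_of_forall_eq_zero {s r : ℕ} {v : Fin n → Fin 4 → K}
    {u : Fin n → MvPolynomial (Fin 4) K} (hv : ∀ j, v j 0 ≠ 0) (hu : IsDualFamily v s u)
    (hr : 1 ≤ r) (h : ∀ f : MvPolynomial (Fin 4) K, f.IsHomogeneous (r * (s + 3) - 2) →
      (∀ j, VanishesAt (v j) (3 * r - 1) f) → f = 0) :
    fatIdeal v (3 * r - 1) ≤ irrIdeal K ^ (2 * r - 1) * fatIdeal v 1 ^ r := by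
  refine fatIdeal_le_of_degree_bound hv hu (by omega) fun t f hf hf0 => ?_
  rw [mem_gradedPart] at hf
  by_contra! ht
  have e : r * (s + 3) = r * (s + 1) + 2 * r := by ring
  have ht' : r * (s + 3) - 2 = (r * (s + 3) - 2 - t) + t := by omega
  refine mul_ne_zero (pow_ne_zero (r * (s + 3) - 2 - t) (X_ne_zero (0 : Fin 4))) hf0
    (h _ ?_ fun j => ?_)
  · rw [ht', Nat.add_sub_cancel]
    exact (isHomogeneous_X_pow _ _).mul hf.2
  · exact vanishesAt_of_mem_pointIdeal_pow (Ideal.mul_mem_left _ _ (mem_fatIdeal.1 hf.1 j))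

end Generic

lemma le_add_three_choose_three (n : ℕ) : n ≤ (n + 3).choose 3 := by
  induction n with
  | zero => simp
  | succ n ih =>
    have h : (n + 1 + 3).choose 3 = (n + 3).choose 2 + (n + 3).choose 3 :=
      Nat.choose_succ_succ' (n + 3) 2
    have := Nat.choose_pos (show 2 ≤ n + 3 by omega)
    omega

theorem containment_3r_sub_1 (K : Type) [Field K] [CharZero K] (n r : ℕ)
    (hn : 1 ≤ n) (hr : 1 ≤ r) :
    ∃ G : MvPolynomial (Fin n × Fin 4) K, G ≠ 0 ∧
      ∀ v : Fin n → Fin 4 → K, (∀ j, v j ≠ 0) →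
        eval (fun p => v p.1 p.2) G ≠ 0 →
        (⨅ j, pointIdeal K (v j) ^ (3 * r - 1)) ≤
          irrIdeal K ^ (2 * r - 1) * (⨅ j, pointIdeal K (v j)) ^ r := by
  suffices h : HoldsGenerically fun v : Fin n → Fin 4 → K =>
      fatIdeal v (3 * r - 1) ≤ irrIdeal K ^ (2 * r - 1) * fatIdeal v 1 ^ r by
    obtain ⟨G, hG, h⟩ := h
    refine ⟨G, hG, fun v _ hv => ?_⟩
    rw [← fatIdeal_one]
    exact h v hv
  obtain rfl | hr2 := hr.eq_or_lt'
  · refine ⟨1, one_ne_zero, fun v _ => ?_⟩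
    simpa using fatIdeal_two_le hn
  by_cases h23 : 2 ≤ n ∧ n ≤ 3
  · refine (holdsGenerically_exists_mulVec_coordPoints (h23.2.trans (by norm_num))).mono
      fun v ⟨A, hA, hAv⟩ => fatIdeal_le_of_linSubst hA hAv ?_
    exact fatIdeal_coordPoints_le _ h23.1 h23.2 hr
  have hex : ∃ s, n ≤ (s + 3).choose 3 := ⟨n, le_add_three_choose_three n⟩
  set s := Nat.find hex
  have hs : n ≤ (s + 3).choose 3 := Nat.find_spec hex
  have hsn : s ≠ 0 → (s + 2).choose 3 < n := by
    intro h0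
    have := Nat.find_min hex (m := s - 1) (by omega)
    rwa [show s - 1 + 3 = s + 2 by omega, not_le] at this
  have hs1 : s = 1 → 4 ≤ n := by
    intro h1
    have := hsn (by omega)
    rw [h1] at this
    norm_num at this
    omega
  obtain ⟨v₀, h₀⟩ := exists_points_forall_eq_zero (K := K) hr2 hn hs1 hsn
  exact ((holdsGenerically_ne_zero.and (holdsGenerically_exists_isDualFamily hs)).and
    (holdsGenerically_forall_eq_zero v₀ h₀)).mono fun v ⟨⟨hv, u, hu⟩, h⟩ =>
      fatIdeal_le_of_forall_eq_zero hv hu hr h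

end
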